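/- Let 0 < a < b, N ∈ ℕ, α = (α₁,…,α_N) ∈ (0,∞)^N, and l = (l₁,…,l_N) ∈ ℝ^N with 0 ≤ l₁ < ⋯ < l_N ≤ 1, and suppose GPFP(a,b,N,α,l) is a probability measure. Let X be a random variable with law GPFP(a,b,N,α,l). Then for every real r ≤ −1 the law of X^r (the pushforward of GPFP(a,b,N,α,l) under x ↦ x^r) belongs to the class UI. -/

import Mathlib

open MeasureTheory Set

/-- The Cauchy transform of a measure on `ℝ`, `G_μ(z) = ∫ (z-x)⁻¹ dμ(x)`. -/
noncomputable def cauchyTransform (μ : Measure ℝ) (z : ℂ) : ℂ :=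
  ∫ x : ℝ, (z - (x : ℂ))⁻¹ ∂μ

/-- The class UI: the right inverse of the Cauchy transform, defined on some triangular
domain `Λ_{γ,δ} = {w ∈ ℂ⁻ : γ|Re w| < -Im w, Im w > -δ}`, has a univalent (injective)
analytic continuation `F` to the whole lower half-plane. -/
def IsUI (μ : Measure ℝ) : Prop :=
  ∃ F : ℂ → ℂ,
    AnalyticOnNhd ℂ F {z : ℂ | z.im < 0} ∧
    Set.InjOn F {z : ℂ | z.im < 0} ∧
    ∃ γ : ℝ, 0 < γ ∧ ∃ δ : ℝ, 0 < δ ∧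
      ∀ w : ℂ, γ * |w.re| < -w.im → -δ < w.im →
        0 < (F w).im ∧ cauchyTransform μ (F w) = w

/-- Density of the generalized power distribution with free Poisson term:
`f(x) = (√((b-x)(x-a))/x) · Σ_k α_k x^{-l_k}`. -/
noncomputable def gpfpDensity (a b : ℝ) (N : ℕ) (α l : Fin N → ℝ) (x : ℝ) : ℝ :=
  Real.sqrt ((b - x) * (x - a)) / x * ∑ k : Fin N, α k * x ^ (-(l k))

/-- The GPFP measure: the measure on `(a,b)` with density `gpfpDensity`. -/
noncomputable def GPFP (a b : ℝ) (N : ℕ) (α l : Fin N → ℝ) : Measure ℝ :=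
  MeasureTheory.volume.withDensity
    (fun x => ENNReal.ofReal ((Set.Ioo a b).indicator (gpfpDensity a b N α l) x))

open Filter Topology Complex

/-- A holomorphic function on a connected open set that is not constant has countably many
critical points. -/
theorem countable_critical_points {D : Set ℂ} (hDo : IsOpen D) (hDc : IsConnected D) {f : ℂ → ℂ}
    (hf : AnalyticOnNhd ℂ f D) (hnc : ¬∃ c, ∀ z ∈ D, f z = c) :
    ({z | deriv f z = 0} ∩ D).Countable := by
  have hx : ∃ x ∈ D, deriv f x ≠ 0 := by
    by_contra! h
    obtain ⟨x₀, hx₀⟩ := hDc.nonempty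
    refine hnc ⟨f x₀, fun z hz => ?_⟩
    exact hDo.is_const_of_deriv_eq_zero hDc.isPreconnected hf.differentiableOn h hz hx₀
  obtain ⟨x, hxD, hx⟩ := hx
  have h := hf.deriv.preimage_zero_mem_codiscreteWithin hx hxD hDc
  have hd : DiscreteTopology ↑({z | deriv f z = 0} ∩ D) := by
    refine isDiscrete_iff_discreteTopology.mp (isDiscrete_of_codiscreteWithin (U := D) ?_)
    convert h using 1
    ext z
    simp
  exact TopologicalSpace.separableSpace_iff_countable.1 inferInstance

/-- The lower half-plane stays connected after removing a countable set. -/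
theorem isPreconnected_lowerHalfPlane_diff {C : Set ℂ} (hC : C.Countable) :
    IsPreconnected ({w : ℂ | w.im < 0} \ C) := by
  let e : ℂ → ℂ := fun z => ⟨z.re, -Real.exp z.im⟩
  have he : Function.Injective e := by
    intro x y h
    have h1 := congrArg Complex.re h
    have h2 := congrArg Complex.im h
    simp only [e, neg_inj, Real.exp_eq_exp] at h1 h2
    exact Complex.ext h1 h2
  have hec : Continuous e := by
    have : e = fun z : ℂ => ((z.re : ℂ) + ((-Real.exp z.im : ℝ) : ℂ) * I) := by
      ext z
      apply Complex.ext <;> simp [e, -Complex.ofReal_exp]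
    rw [this]
    fun_prop
  have hc : (e ⁻¹' C).Countable := hC.preimage_of_injOn he.injOn
  have hp := (hc.isPathConnected_compl_of_one_lt_rank
    (by simp)).isConnected.isPreconnected.image e hec.continuousOn
  convert hp using 1
  ext w
  constructor
  · rintro ⟨hw, hwC⟩
    have : e ⟨w.re, Real.log (-w.im)⟩ = w := by
      apply Complex.ext
      · simp [e]
      · simp only [e]
        rw [Real.exp_log (by simpa using hw)]
        ring
    exact ⟨_, by rwa [Set.mem_compl_iff, Set.mem_preimage, this], this⟩
  · rintro ⟨z, hz, rfl⟩
    exact ⟨by simp [e, Real.exp_pos], hz⟩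

/-- Let `f` be a nonconstant holomorphic function on a connected open set `D` which is proper over
the lower half-plane. If all values `-iM` with `M` large have at most one preimage,
then `f` has a holomorphic inverse on the lower half-plane. -/
theorem exists_inverse_of_proper {D : Set ℂ} (hDo : IsOpen D) (hDc : IsConnected D) {f : ℂ → ℂ}
    (hf : AnalyticOnNhd ℂ f D) (hnc : ¬∃ c, ∀ z ∈ D, f z = c)
    (hval : ∃ z ∈ D, (f z).im < 0)
    (hproper : ∀ U : Ultrafilter ℂ, D ∈ U → ∀ w : ℂ, w.im < 0 → Tendsto f U (𝓝 w) →
      ∃ z ∈ D, (U : Filter ℂ) ≤ 𝓝 z)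
    (huniq : ∃ M₀ : ℝ, ∀ M : ℝ, M₀ ≤ M → ∀ z ∈ D, ∀ z' ∈ D, f z = -(M * I) → f z' = -(M * I) →
      z = z') :
    ∃ F : ℂ → ℂ, AnalyticOnNhd ℂ F {z : ℂ | z.im < 0} ∧ Set.InjOn F {z : ℂ | z.im < 0} ∧
      ∀ z ∈ D, (f z).im < 0 → F (f z) = z := by
  set H : Set ℂ := {z : ℂ | z.im < 0} with hH
  have hHo : IsOpen H := isOpen_lt Complex.continuous_im continuous_const
  have hopen : ∀ s ⊆ D, IsOpen s → IsOpen (f '' s) :=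
    (hf.is_constant_or_isOpen hDc.isPreconnected).resolve_left hnc
  have hcont : ∀ z ∈ D, ContinuousAt f z := fun z hz => (hf z hz).continuousAt
  -- limits along ultrafilters
  have hlim : ∀ U : Ultrafilter ℂ, D ∈ U → ∀ w ∈ H, Tendsto f U (𝓝 w) →
      ∃ z ∈ D, (U : Filter ℂ) ≤ 𝓝 z ∧ f z = w := by
    intro U hU w hw ht
    obtain ⟨z, hz, hUz⟩ := hproper U hU w hw ht
    exact ⟨z, hz, hUz, tendsto_nhds_unique ((hcont z hz).mono_left hUz) ht⟩
  have hHpre : IsPreconnected H := by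
    simpa using isPreconnected_lowerHalfPlane_diff Set.countable_empty
  have hsurj : ∀ w ∈ H, ∃ z ∈ D, f z = w := by
    have hsub : H ⊆ f '' D := by
      refine hHpre.subset_of_closure_inter_subset (hopen D le_rfl hDo) ?_ ?_
      · obtain ⟨z, hz, hzw⟩ := hval
        exact ⟨f z, hzw, z, hz, rfl⟩
      · rintro w ⟨hw, hwH⟩
        obtain ⟨g, hg, hgw⟩ := mem_closure_iff_ultrafilter.1 hw
        choose! k hkD hk using (fun (w : ℂ) (hw : w ∈ f '' D) => (hw : ∃ z, z ∈ D ∧ f z = w))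
        have ht : Tendsto f (g.map k : Ultrafilter ℂ) (𝓝 w) := by
          rw [Ultrafilter.coe_map, tendsto_map'_iff]
          exact (tendsto_id.mono_left hgw).congr'
            (by filter_upwards [hg] with v hv using (hk v hv).symm)
        obtain ⟨z, hz, -, hzw⟩ := hlim (g.map k)
          (Ultrafilter.mem_map.2 (by filter_upwards [hg] with v hv using hkD v hv)) w hwH ht
        exact ⟨z, hz, hzw⟩
    exact fun w hw => hsub hw
  set V : Set ℂ := {w | ∀ z ∈ D, ∀ z' ∈ D, f z = w → f z' = w → z = z'} with hV
  -- uniqueness of preimages is a closed condition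
  have hVclosed : ∀ w ∈ closure V, w ∈ V := by
    intro w hw z hz z' hz' hzw hzw'
    by_contra hne
    obtain ⟨N, N', hN, hN', hzN, hzN', hdisj⟩ := t2_separation hne
    have h1 := (hopen (N ∩ D) Set.inter_subset_right (hN.inter hDo)).mem_nhds
      (show w ∈ f '' (N ∩ D) from ⟨z, ⟨hzN, hz⟩, hzw⟩)
    have h2 := (hopen (N' ∩ D) Set.inter_subset_right (hN'.inter hDo)).mem_nhds
      (show w ∈ f '' (N' ∩ D) from ⟨z', ⟨hzN', hz'⟩, hzw'⟩)
    obtain ⟨v, ⟨⟨a, ha, hav⟩, b, hb, hbv⟩, hvV⟩ := mem_closure_iff_nhds.1 hw _ (inter_mem h1 h2)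
    have hab : a = b := hvV a ha.2 b hb.2 hav hbv
    exact Set.disjoint_left.1 hdisj ha.1 (hab ▸ hb.1)
  set C : Set ℂ := f '' ({z | deriv f z = 0} ∩ D) with hC
  have hCc : C.Countable := (countable_critical_points hDo hDc hf hnc).image f
  have hderiv : ∀ w ∉ C, ∀ z ∈ D, f z = w → deriv f z ≠ 0 :=
    fun w hw z hz hzw h0 => hw ⟨z, ⟨h0, hz⟩, hzw⟩
  have hVopen : ∀ w ∈ H, w ∉ C → w ∈ V → V ∈ 𝓝 w := by
    intro w hwH hwC hwV
    by_contra hn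
    have hcl : w ∈ closure Vᶜ := by
      rwa [closure_compl, Set.mem_compl_iff, mem_interior_iff_mem_nhds]
    obtain ⟨g, hg, hgw⟩ := mem_closure_iff_ultrafilter.1 hcl
    have hex : ∀ v ∈ Vᶜ, ∃ z, ∃ z', z ∈ D ∧ z' ∈ D ∧ f z = v ∧ f z' = v ∧ z ≠ z' := by
      intro v hv
      simp only [hV, Set.mem_compl_iff, Set.mem_ofPred_eq] at hv
      push Not at hv
      obtain ⟨z, hz, z', hz', h1, h2, h3⟩ := hv
      exact ⟨z, z', hz, hz', h1, h2, h3⟩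
    choose! k k' hkD hkD' hk hk' hkk using hex
    have key : ∀ k : ℂ → ℂ, (∀ v ∈ Vᶜ, k v ∈ D) → (∀ v ∈ Vᶜ, f (k v) = v) →
        ∃ z ∈ D, Tendsto k g (𝓝 z) ∧ f z = w := by
      intro k hkD hk
      have ht : Tendsto f (g.map k : Ultrafilter ℂ) (𝓝 w) := by
        rw [Ultrafilter.coe_map, tendsto_map'_iff]
        exact (tendsto_id.mono_left hgw).congr'
            (by filter_upwards [hg] with v hv using (hk v hv).symm)
      exact hlim (g.map k)
        (Ultrafilter.mem_map.2 (by filter_upwards [hg] with v hv using hkD v hv)) w hwH ht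
    obtain ⟨z, hz, hkz, hzw⟩ := key k hkD hk
    obtain ⟨z', hz', hkz', hzw'⟩ := key k' hkD' hk'
    obtain rfl : z = z' := hwV z hz z' hz' hzw hzw'
    have hs := (hf z hz).hasStrictDerivAt
    have hl := hs.eventually_left_inverse (hderiv w hwC z hz hzw)
    have : ∀ᶠ v in (g : Filter ℂ), False := by
      filter_upwards [hg, hkz.eventually hl, hkz'.eventually hl] with v hv h1 h2
      refine hkk v hv ?_
      rw [← h1, ← h2, hk v hv, hk' v hv]
    exact g.neBot.ne (by simpa using this)
  have hHC : H \ C ⊆ interior V := by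
    refine (isPreconnected_lowerHalfPlane_diff hCc).subset_of_closure_inter_subset
      isOpen_interior ?_ ?_
    · obtain ⟨M₀, hM⟩ := huniq
      have hinj : Function.Injective (fun M : ℝ => (-(M * I) : ℂ)) := by
        intro x y h
        simpa using h
      have hcount : ((fun M : ℝ => (-(M * I) : ℂ)) ⁻¹' C).Countable :=
        hCc.preimage_of_injOn hinj.injOn
      have hunc : ¬(Set.Ioi (max M₀ 0)).Countable := by
        intro h
        have h1 := Cardinal.le_aleph0_iff_set_countable.2 h
        rw [Cardinal.mk_Ioi_real] at h1
        exact not_le.2 Cardinal.aleph0_lt_continuum h1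
      obtain ⟨M, hM1, hM2⟩ : ∃ M ∈ Set.Ioi (max M₀ 0), (-(M * I) : ℂ) ∉ C := by
        by_contra! h
        exact hunc (hcount.mono h)
      have hM1' := max_lt_iff.1 (Set.mem_Ioi.1 hM1)
      have hMH : (-(M * I) : ℂ) ∈ H := by simpa [hH] using hM1'.2
      exact ⟨_, ⟨hMH, hM2⟩, mem_interior_iff_mem_nhds.2 (hVopen _ hMH hM2 (hM M hM1'.1.le))⟩
    · rintro w ⟨hw, hwH, hwC⟩
      exact mem_interior_iff_mem_nhds.2
        (hVopen w hwH hwC (hVclosed w (closure_mono interior_subset hw)))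
  have hHV : H ⊆ V := by
    intro w hw
    refine hVclosed w (closure_mono (hHC.trans interior_subset) ?_)
    have := (hCc.dense_compl ℝ).open_subset_closure_inter hHo hw
    rwa [Set.sdiff_eq]
  choose! F hFD hF using hsurj
  have hFc : ∀ w ∈ H, ContinuousAt F w := by
    intro w hw
    rw [ContinuousAt, tendsto_iff_ultrafilter]
    intro g hg
    have hgH : H ∈ g := hg (hHo.mem_nhds hw)
    have ht : Tendsto f (g.map F : Ultrafilter ℂ) (𝓝 w) := by
      rw [Ultrafilter.coe_map, tendsto_map'_iff]
      exact (tendsto_id.mono_left hg).congr'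
          (by filter_upwards [hgH] with v hv using (hF v hv).symm)
    obtain ⟨z, hz, hgz, hzw⟩ := hlim (g.map F)
      (Ultrafilter.mem_map.2 (by filter_upwards [hgH] with v hv using hFD v hv)) w hw ht
    rwa [hHV hw (F w) (hFD w hw) z hz (hF w hw) hzw]
  have hFd : ∀ w ∈ H, w ∉ C → DifferentiableAt ℂ F w := by
    intro w hw hwC
    refine (HasDerivAt.of_local_left_inverse (hFc w hw)
      (hf (F w) (hFD w hw)).differentiableAt.hasDerivAt
      (hderiv w hwC _ (hFD w hw) (hF w hw)) ?_).differentiableAt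
    filter_upwards [hHo.mem_nhds hw] with v hv using hF v hv
  refine ⟨F, fun w hw => ?_, fun w hw v hv h => ?_, fun z hz hzH => ?_⟩
  · obtain ⟨R, hR, hRH⟩ := Metric.nhds_basis_closedBall.mem_iff.1 (hHo.mem_nhds hw)
    lift R to NNReal using hR.le
    exact (Complex.hasFPowerSeriesOnBall_of_differentiable_off_countable hCc
      (fun v hv => (hFc v (hRH hv)).continuousWithinAt)
      (fun v hv => hFd v (hRH (Metric.ball_subset_closedBall hv.1)) hv.2)
      (by exact_mod_cast hR)).analyticAt
  · rw [← hF w hw, ← hF v hv, h]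
  · exact hHV hzH (F (f z)) (hFD _ hzH) z hz (hF _ hzH) rfl

/-- Differentiability of a parametric integral of holomorphic functions which is locally
dominated. -/
theorem differentiableOn_integral_of_locally_dominated {O : Set ℂ} {μ : Measure ℝ}
    {F : ℂ → ℝ → ℂ} (hdiff : ∀ᵐ y ∂μ, DifferentiableOn ℂ (fun z => F z y) O)
    (hmeas : ∀ z ∈ O, AEStronglyMeasurable (F z) μ)
    (hbound : ∀ z₀ ∈ O, ∃ r > 0, Metric.closedBall z₀ r ⊆ O ∧ ∃ b : ℝ → ℝ, Integrable b μ ∧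
      ∀ᵐ y ∂μ, ∀ z ∈ Metric.closedBall z₀ r, ‖F z y‖ ≤ b y) :
    DifferentiableOn ℂ (fun z => ∫ y, F z y ∂μ) O := by
  intro z₀ hz₀
  obtain ⟨r, hr, hrO, b, hb, hFb⟩ := hbound z₀ hz₀
  have hballO : Metric.ball z₀ r ⊆ O := Metric.ball_subset_closedBall.trans hrO
  have hd : ∀ᵐ y ∂μ, ∀ z ∈ Metric.ball z₀ r, HasDerivAt (fun z => F z y)
      (deriv (fun z => F z y) z) z := by
    filter_upwards [hdiff] with y hy z hz
    exact ((hy.mono hballO).differentiableAt (Metric.isOpen_ball.mem_nhds hz)).hasDerivAt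
  have hmeas' : AEStronglyMeasurable (fun y => deriv (fun z => F z y) z₀) μ := by
    let e : ℕ → ℂ := fun n => ((r / (n + 2) : ℝ) : ℂ)
    have he0 : Tendsto e atTop (𝓝[≠] 0) := by
      rw [tendsto_nhdsWithin_iff]
      constructor
      · have h2 : Tendsto (fun n : ℕ => r / ((n : ℝ) + 2)) atTop (𝓝 0) :=
          tendsto_const_nhds.div_atTop
            (tendsto_atTop_add_const_right _ _ tendsto_natCast_atTop_atTop)
        have := (Complex.continuous_ofReal.tendsto 0).comp h2
        simpa [e, Function.comp_def] using this
      · refine Eventually.of_forall fun n => ?_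
        simp only [e, Set.mem_compl_iff, Set.mem_singleton_iff, Complex.ofReal_eq_zero]
        positivity
    refine aestronglyMeasurable_of_tendsto_ae atTop
      (f := fun n y => (e n)⁻¹ * (F (z₀ + e n) y - F z₀ y)) (fun n => ?_) ?_
    · refine ((hmeas _ (hballO ?_)).sub (hmeas _ hz₀)).const_mul _
      have hn : (1 : ℝ) < n + 2 := by
        have := n.cast_nonneg (α := ℝ)
        linarith
      simp only [e, Metric.mem_ball, dist_self_add_left, Complex.norm_real, Real.norm_eq_abs]
      rw [abs_of_pos (by positivity), div_lt_iff₀ (by positivity)]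
      nlinarith
    · filter_upwards [hd] with y hy
      have := (hasDerivAt_iff_tendsto_slope_zero.1 (hy z₀ (Metric.mem_ball_self hr)))
      exact this.comp he0
  refine (hasDerivAt_integral_of_dominated_loc_of_deriv_le (s := Metric.ball z₀ (r / 2))
    (F' := fun z y => deriv (fun z => F z y) z)
    (bound := fun y => b y / (r / 2)) (Metric.ball_mem_nhds _ (by positivity)) ?_ ?_ hmeas' ?_
    (hb.div_const _) ?_).2.differentiableAt.differentiableWithinAt
  · filter_upwards [Metric.ball_mem_nhds z₀ hr] with z hz using hmeas z (hballO hz)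
  · refine hb.mono' (hmeas z₀ hz₀) ?_
    filter_upwards [hFb] with y hy using hy z₀ (Metric.mem_closedBall_self hr.le)
  · filter_upwards [hFb, hdiff] with y hy hyd z hz
    have hsub : Metric.closedBall z (r / 2) ⊆ Metric.closedBall z₀ r :=
      Metric.closedBall_subset_closedBall' (by
        have := (Metric.mem_ball.1 hz).le
        linarith)
    refine Complex.norm_deriv_le_of_forall_mem_sphere_norm_le (by positivity) ?_
      (fun v hv => hy v (hsub (Metric.sphere_subset_closedBall hv)))
    refine DifferentiableOn.diffContOnCl_ball (U := O) hyd (hsub.trans hrO)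
  · filter_upwards [hd] with y hy z hz
    exact hy z (Metric.ball_subset_ball (by linarith) hz)

/-- Mean value inequality for the real part of a rotated difference quotient. -/
theorem re_mul_slope_pos {V : Set ℂ} (hV : Convex ℝ V) {f f' : ℂ → ℂ} {c : ℂ}
    (hf : ∀ z ∈ V, HasDerivAt f (f' z) z) (hpos : ∀ z ∈ V, 0 < (c * f' z).re)
    {x y : ℂ} (hx : x ∈ V) (hy : y ∈ V) (hxy : x ≠ y) : 0 < (c * ((f y - f x) / (y - x))).re := by
  have hne : y - x ≠ 0 := sub_ne_zero.2 hxy.symm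
  let γ : ℝ → ℂ := fun τ => x + τ * (y - x)
  have hγV : ∀ τ ∈ Set.Icc (0 : ℝ) 1, γ τ ∈ V := by
    intro τ hτ
    have := hV.add_smul_sub_mem hx hy hτ
    simpa [γ] using this
  have hγ : ∀ τ : ℝ, HasDerivAt γ (y - x) τ := by
    intro τ
    have := ((hasDerivAt_id (τ : ℝ)).ofReal_comp.mul_const (y - x)).const_add x
    simpa [γ] using this
  let φ : ℝ → ℝ := fun τ => (c * (f (γ τ) / (y - x))).re
  have hφ : ∀ τ ∈ Set.Icc (0 : ℝ) 1, HasDerivAt φ (c * f' (γ τ)).re τ := by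
    intro τ hτ
    have h1 : HasDerivAt (fun τ => c * (f (γ τ) / (y - x))) (c * f' (γ τ)) τ := by
      have := (((hf _ (hγV τ hτ)).comp τ (hγ τ)).div_const (y - x)).const_mul c
      rw [mul_div_cancel_right₀ _ hne] at this
      exact this
    have := Complex.reCLM.hasFDerivAt.comp_hasDerivAt τ h1
    simpa [φ, Function.comp_def] using this
  obtain ⟨τ, hτ, hτe⟩ := exists_hasDerivAt_eq_slope φ (fun τ => (c * f' (γ τ)).re) zero_lt_one
    (fun τ hτ => (hφ τ hτ).continuousAt.continuousWithinAt)
    (fun τ hτ => hφ τ (Set.Ioo_subset_Icc_self hτ))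
  have h2 := hpos _ (hγV τ (Set.Ioo_subset_Icc_self hτ))
  rw [hτe] at h2
  have e0 : γ 0 = x := by simp [γ]
  have e1 : γ 1 = y := by simp [γ]
  simp only [φ, e0, e1] at h2
  rw [sub_div, mul_sub, Complex.sub_re]
  simpa using h2

/-- The Cauchy transform of the measure with density `g` on `(p, q)`. -/
noncomputable def cauchyInt (g : ℝ → ℝ) (p q : ℝ) (z : ℂ) : ℂ :=
  ∫ y in Set.Ioo p q, (g y : ℂ) * (z - y)⁻¹

theorem isClosed_ofReal_Icc (p q : ℝ) : IsClosed (Complex.ofReal '' Set.Icc p q) :=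
  (isCompact_Icc.image Complex.continuous_ofReal).isClosed

theorem cauchyInt_differentiableOn {g : ℝ → ℝ} {p q : ℝ} (hg : IntegrableOn g (Set.Ioo p q)) :
    DifferentiableOn ℂ (cauchyInt g p q) (Complex.ofReal '' Set.Icc p q)ᶜ := by
  have hO : IsOpen (Complex.ofReal '' Set.Icc p q)ᶜ := (isClosed_ofReal_Icc p q).isOpen_compl
  refine differentiableOn_integral_of_locally_dominated ?_ ?_ ?_
  · refine (ae_restrict_mem measurableSet_Ioo).mono fun y hy => ?_
    refine DifferentiableOn.const_mul ?_ _
    refine DifferentiableOn.inv (by fun_prop) fun z hz h0 => hz ?_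
    exact ⟨y, Set.Ioo_subset_Icc_self hy, (sub_eq_zero.1 h0).symm⟩
  · intro z _
    refine (hg.ofReal (𝕜 := ℂ)).aestronglyMeasurable.mul ?_
    exact (by fun_prop : Measurable fun y : ℝ => (z - y : ℂ)⁻¹).aestronglyMeasurable
  · intro z₀ hz₀
    obtain ⟨r, hr, hrO⟩ := Metric.isOpen_iff.1 hO z₀ hz₀
    refine ⟨r / 2, by positivity,
      (Metric.closedBall_subset_ball (by linarith)).trans hrO,
      fun y => ‖g y‖ * (r / 2)⁻¹, (Integrable.norm hg).mul_const _, ?_⟩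
    refine (ae_restrict_mem measurableSet_Ioo).mono fun y hy z hz => ?_
    rw [norm_mul, norm_inv, Complex.norm_real]
    refine mul_le_mul_of_nonneg_left (inv_anti₀ (by positivity) ?_) (norm_nonneg _)
    by_contra! h
    refine hrO (show (y : ℂ) ∈ Metric.ball z₀ r from ?_) ⟨y, Set.Ioo_subset_Icc_self hy, rfl⟩
    have h1 := Metric.mem_closedBall.1 hz
    rw [Metric.mem_ball]
    have h2 : dist (y : ℂ) z < r / 2 := by rwa [dist_comm, dist_eq_norm]
    linarith [dist_triangle (y : ℂ) z z₀]

theorem cauchyInt_im_ofReal (g : ℝ → ℝ) (p q x : ℝ) : (cauchyInt g p q x).im = 0 := by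
  have : cauchyInt g p q x = ((∫ y in Set.Ioo p q, g y * (x - y)⁻¹ : ℝ) : ℂ) := by
    rw [cauchyInt, ← integral_complex_ofReal]
    simp
  rw [this, Complex.ofReal_im]

theorem cauchyInt_integrable {g : ℝ → ℝ} {p q : ℝ} (hg : IntegrableOn g (Set.Ioo p q)) {z : ℂ}
    (hz : z.im ≠ 0) : IntegrableOn (fun y : ℝ => (g y : ℂ) * (z - y)⁻¹) (Set.Ioo p q) := by
  refine Integrable.mul_bdd (c := |z.im|⁻¹) (hg.ofReal (𝕜 := ℂ))
    (by fun_prop : Measurable fun y : ℝ => (z - y : ℂ)⁻¹).aestronglyMeasurable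
    (Eventually.of_forall fun y => ?_)
  rw [norm_inv]
  have := abs_pos.2 hz
  gcongr
  simpa using Complex.abs_im_le_norm (z - y)

theorem cauchyInt_im {g : ℝ → ℝ} {p q : ℝ} (hg : IntegrableOn g (Set.Ioo p q)) {z : ℂ}
    (hz : z.im ≠ 0) : (cauchyInt g p q z).im =
      ∫ y in Set.Ioo p q, -z.im * (g y * (Complex.normSq (z - y))⁻¹) := by
  have h := Complex.imCLM.integral_comp_comm (cauchyInt_integrable hg hz)
  simp only [Complex.imCLM_apply] at h
  rw [cauchyInt, ← h]
  refine integral_congr_ae (Eventually.of_forall fun y => ?_)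
  simp
  ring

theorem cauchyInt_im_neg {g : ℝ → ℝ} {p q : ℝ} (hpq : p < q) (hg : IntegrableOn g (Set.Ioo p q))
    (hpos : ∀ y ∈ Set.Ioo p q, 0 < g y) {z : ℂ} (hz : 0 < z.im) : (cauchyInt g p q z).im < 0 := by
  rw [cauchyInt_im hg hz.ne']
  have hns : ∀ y : ℝ, 0 < (Complex.normSq (z - y))⁻¹ := fun y =>
    inv_pos.2 (Complex.normSq_pos.2 fun h => hz.ne' (by simpa using congrArg Complex.im h))
  have hint : IntegrableOn (fun y : ℝ => z.im * (g y * (Complex.normSq (z - y))⁻¹))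
      (Set.Ioo p q) := by
    have h1 := (cauchyInt_integrable hg hz.ne').im.neg
    refine h1.congr (Eventually.of_forall fun y => ?_)
    simp
    ring
  have : 0 < ∫ y in Set.Ioo p q, z.im * (g y * (Complex.normSq (z - y))⁻¹) := by
    rw [setIntegral_pos_iff_support_of_nonneg_ae]
    · have : Set.Ioo p q ⊆ Function.support
          (fun y : ℝ => z.im * (g y * (Complex.normSq (z - y))⁻¹)) ∩ Set.Ioo p q :=
        fun y hy => ⟨(mul_pos hz (mul_pos (hpos y hy) (hns y))).ne', hy⟩
      refine lt_of_lt_of_le ?_ (measure_mono this)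
      simpa using hpq
    · refine (ae_restrict_mem measurableSet_Ioo).mono fun y hy => ?_
      exact (mul_pos hz (mul_pos (hpos y hy) (hns y))).le
    · exact hint
  simp only [neg_mul, integral_neg]
  linarith

theorem cauchyInt_im_nonneg {g : ℝ → ℝ} {p q : ℝ} (hg : IntegrableOn g (Set.Ioo p q))
    (hpos : ∀ y ∈ Set.Ioo p q, 0 < g y) {z : ℂ} (hz : z.im ≤ 0) : 0 ≤ (cauchyInt g p q z).im := by
  rcases hz.eq_or_lt with h | h
  · have : z = (z.re : ℂ) := Complex.ext rfl (by simpa using h)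
    rw [this, cauchyInt_im_ofReal]
  · rw [cauchyInt_im hg h.ne]
    refine setIntegral_nonneg measurableSet_Ioo fun y hy => ?_
    exact mul_nonneg (by linarith)
      (mul_nonneg (hpos y hy).le (inv_nonneg.2 (Complex.normSq_nonneg _)))

/-- The germ at infinity of `cauchyInt`. -/
theorem exists_cauchyInt_germ {g : ℝ → ℝ} {p q : ℝ} (hp : 0 < p) (hpq : p < q)
    (hg : IntegrableOn g (Set.Ioo p q)) :
    ∃ ψ : ℂ → ℂ, ∃ ε > 0, DifferentiableOn ℂ ψ (Metric.ball 0 ε) ∧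
      ψ 0 = ((∫ y in Set.Ioo p q, g y : ℝ) : ℂ) ∧
      ∀ ζ, ζ ≠ 0 → cauchyInt g p q ζ⁻¹ = ζ * ψ ζ := by
  have hq : 0 < q := hp.trans hpq
  have key : ∀ ζ ∈ Metric.ball (0 : ℂ) (2 * q)⁻¹, ∀ y ∈ Set.Ioo p q, 1 / 2 ≤ ‖1 - ζ * y‖ := by
    intro ζ hζ y hy
    have h1 : ‖ζ‖ < (2 * q)⁻¹ := by simpa using hζ
    have h2 : ‖ζ * y‖ ≤ 1 / 2 := by
      rw [norm_mul, Complex.norm_real, Real.norm_eq_abs, abs_of_pos (hp.trans hy.1)]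
      calc ‖ζ‖ * y ≤ (2 * q)⁻¹ * q := by
            have := hp.trans hy.1
            have := hy.2
            gcongr
        _ = 1 / 2 := by field_simp
    have h3 := norm_sub_norm_le (1 : ℂ) (ζ * y)
    rw [norm_one] at h3
    linarith
  refine ⟨fun ζ => ∫ y in Set.Ioo p q, (g y : ℂ) * (1 - ζ * y)⁻¹, (2 * q)⁻¹, by positivity,
    ?_, ?_, ?_⟩
  · refine differentiableOn_integral_of_locally_dominated ?_ ?_ ?_
    · refine (ae_restrict_mem measurableSet_Ioo).mono fun y hy => ?_
      refine DifferentiableOn.const_mul ?_ _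
      refine DifferentiableOn.inv (by fun_prop) fun z hz h0 => ?_
      have := key z hz y hy
      rw [h0, norm_zero] at this
      norm_num at this
    · intro z _
      refine (hg.ofReal (𝕜 := ℂ)).aestronglyMeasurable.mul ?_
      exact (by fun_prop : Measurable fun y : ℝ => (1 - z * y : ℂ)⁻¹).aestronglyMeasurable
    · intro z₀ hz₀
      obtain ⟨r, hr, hrO⟩ := Metric.nhds_basis_closedBall.mem_iff.1
        (Metric.isOpen_ball.mem_nhds hz₀)
      refine ⟨r, hr, hrO, fun y => ‖g y‖ * (1 / 2)⁻¹, (Integrable.norm hg).mul_const _, ?_⟩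
      refine (ae_restrict_mem measurableSet_Ioo).mono fun y hy z hz => ?_
      rw [norm_mul, norm_inv, Complex.norm_real]
      refine mul_le_mul_of_nonneg_left (inv_anti₀ (by positivity) ?_) (norm_nonneg _)
      exact key z (hrO hz) y hy
  · simp [integral_complex_ofReal]
  · intro ζ hζ
    rw [cauchyInt, ← integral_const_mul]
    refine integral_congr_ae (Eventually.of_forall fun y => ?_)
    have : ζ⁻¹ - y = ζ⁻¹ * (1 - ζ * y) := by field_simp
    simp only [this, mul_inv, inv_inv]
    ring

theorem cauchyInt_tendsto_cobounded {g : ℝ → ℝ} {p q : ℝ} (hp : 0 < p) (hpq : p < q)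
    (hg : IntegrableOn g (Set.Ioo p q)) :
    Tendsto (cauchyInt g p q) (Bornology.cobounded ℂ) (𝓝 0) := by
  obtain ⟨ψ, ε, hε, hψ, -, hψe⟩ := exists_cauchyInt_germ hp hpq hg
  have hc : ContinuousAt ψ 0 :=
    (hψ.differentiableAt (Metric.ball_mem_nhds 0 hε)).continuousAt
  have h1 : Tendsto (fun ζ => ζ * ψ ζ) (𝓝 0) (𝓝 0) := by
    have := (continuousAt_id (x := (0 : ℂ))).mul hc
    simpa [ContinuousAt, Pi.mul_def] using this
  have h2 := h1.comp (tendsto_inv₀_cobounded (α := ℂ))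
  refine h2.congr' ?_
  filter_upwards [Bornology.eventually_ne_cobounded (0 : ℂ)] with z hz
  simp only [Function.comp]
  rw [← hψe z⁻¹ (inv_ne_zero hz), inv_inv]

theorem exists_cauchyInt_eq {g : ℝ → ℝ} {p q : ℝ} (hp : 0 < p) (hpq : p < q)
    (hg : IntegrableOn g (Set.Ioo p q)) (hpos : ∀ y ∈ Set.Ioo p q, 0 < g y) :
    ∃ δ > 0, ∀ w : ℂ, ‖w‖ < δ → w.im < 0 → ∃ z : ℂ, 0 < z.im ∧ cauchyInt g p q z = w := by
  obtain ⟨ψ, ε, hε, hψ, hψ0, hψe⟩ := exists_cauchyInt_germ hp hpq hg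
  have hne : ψ 0 ≠ 0 := by
    rw [hψ0, Complex.ofReal_ne_zero]
    refine ne_of_gt ?_
    rw [setIntegral_pos_iff_support_of_nonneg_ae]
    · have : Set.Ioo p q ⊆ Function.support g ∩ Set.Ioo p q := fun y hy => ⟨(hpos y hy).ne', hy⟩
      refine lt_of_lt_of_le ?_ (measure_mono this)
      simpa using hpq
    · exact (ae_restrict_mem measurableSet_Ioo).mono fun y hy => (hpos y hy).le
    · exact hg
  have hd : AnalyticAt ℂ (fun ζ => ζ * ψ ζ) 0 :=
    analyticAt_id.mul (hψ.analyticAt (Metric.ball_mem_nhds 0 hε))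
  have hs := hd.hasStrictDerivAt
  have hd0 : deriv (fun ζ => ζ * ψ ζ) 0 = ψ 0 := by
    have := (hasDerivAt_id (0 : ℂ)).mul
      (hψ.differentiableAt (Metric.ball_mem_nhds 0 hε)).hasDerivAt
    have h := this.deriv
    simpa [Pi.mul_def] using h
  have hm := hs.map_nhds_eq (by rwa [hd0])
  simp only [zero_mul] at hm
  have h1 : (fun ζ => ζ * ψ ζ) '' Set.univ ∈ 𝓝 (0 : ℂ) := by
    rw [← hm]
    exact image_mem_map univ_mem
  obtain ⟨δ, hδ, hδs⟩ := Metric.mem_nhds_iff.1 h1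
  refine ⟨δ, hδ, fun w hw hwim => ?_⟩
  obtain ⟨ζ, -, hζ⟩ := hδs (show w ∈ Metric.ball 0 δ by simpa using hw)
  have hζ0 : ζ ≠ 0 := by
    rintro rfl
    simp only [zero_mul] at hζ
    rw [← hζ] at hwim
    simp at hwim
  have he : cauchyInt g p q ζ⁻¹ = w := by rw [hψe ζ hζ0]; exact hζ
  refine ⟨ζ⁻¹, ?_, he⟩
  by_contra! h
  have := cauchyInt_im_nonneg hg hpos h
  rw [he] at this
  linarith

theorem one_sub_mul_ne_zero {ζ ξ : ℂ} (hζ : ‖ζ‖ < 1) (hξ : ‖ξ‖ ≤ 1) : 1 - ζ * ξ ≠ 0 := by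
  intro h
  have h1 : ‖ζ * ξ‖ = 1 := by rw [← sub_eq_zero.1 h, norm_one]
  rw [norm_mul] at h1
  nlinarith [norm_nonneg ζ, norm_nonneg ξ]

theorem quadratic_cos_eq_mul (ζ : ℂ) (φ : ℝ) : 1 + ζ ^ 2 - 2 * ζ * Real.cos φ =
    (1 - ζ * exp (φ * I)) * (1 - ζ * exp (-(φ * I))) := by
  have h1 : exp (φ * I) * exp (-(φ * I)) = 1 := by rw [← Complex.exp_add]; simp
  have h2 : exp (φ * I) + exp (-(φ * I)) = 2 * Real.cos φ := by
    rw [Complex.ofReal_cos, Complex.cos]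
    ring_nf
  linear_combination ζ ^ 2 * (-h1) + ζ * h2

theorem quadratic_cos_ne_zero {ζ : ℂ} (hζ : ‖ζ‖ < 1) (φ : ℝ) :
    1 + ζ ^ 2 - 2 * ζ * Real.cos φ ≠ 0 := by
  rw [quadratic_cos_eq_mul]
  refine mul_ne_zero (one_sub_mul_ne_zero hζ ?_) (one_sub_mul_ne_zero hζ ?_)
  · rw [norm_exp_ofReal_mul_I]
  · rw [← neg_mul, ← ofReal_neg, norm_exp_ofReal_mul_I]

theorem integral_inv_quadratic_cos {ζ : ℂ} (hζ : ‖ζ‖ < 1) :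
    ∫ φ in (0 : ℝ)..Real.pi, (1 + ζ ^ 2 - 2 * ζ * Real.cos φ : ℂ)⁻¹ = Real.pi / (1 - ζ ^ 2) := by
  have hc : (∮ ξ in C(0, 1), (ξ - ζ)⁻¹ • (1 - ζ * ξ)⁻¹) = (2 * Real.pi * I) • (1 - ζ * ζ)⁻¹ := by
    refine DiffContOnCl.circleIntegral_sub_inv_smul (R := 1) (c := 0) (w := ζ)
      (f := fun ξ => (1 - ζ * ξ)⁻¹) ?_ (by simpa using hζ)
    refine DifferentiableOn.diffContOnCl ?_
    rw [closure_ball _ one_ne_zero]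
    refine DifferentiableOn.inv (by fun_prop) fun ξ hξ =>
      one_sub_mul_ne_zero hζ (by simpa using hξ)
  have hint : (∫ φ in (0 : ℝ)..2 * Real.pi, (1 + ζ ^ 2 - 2 * ζ * Real.cos φ : ℂ)⁻¹) =
      2 * Real.pi * (1 - ζ * ζ)⁻¹ := by
    have h1 : I * (∫ φ in (0 : ℝ)..2 * Real.pi, (1 + ζ ^ 2 - 2 * ζ * Real.cos φ : ℂ)⁻¹) =
        I * (2 * Real.pi * (1 - ζ * ζ)⁻¹) := by
      rw [← intervalIntegral.integral_const_mul]
      refine Eq.trans ?_ (hc.trans (by simp only [smul_eq_mul]; ring))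
      rw [circleIntegral]
      refine intervalIntegral.integral_congr fun φ _ => ?_
      simp only [deriv_circleMap, circleMap, smul_eq_mul, ofReal_one, one_mul, zero_add]
      rw [quadratic_cos_eq_mul]
      have h3 : exp (φ * I) ≠ 0 := Complex.exp_ne_zero _
      have h4 : exp (φ * I) - ζ = exp (φ * I) * (1 - ζ * exp (-(φ * I))) := by
        rw [Complex.exp_neg]
        field_simp
      rw [h4, mul_inv, mul_inv]
      field_simp
    exact mul_left_cancel₀ I_ne_zero h1
  have hcont : Continuous fun φ : ℝ => (1 + ζ ^ 2 - 2 * ζ * Real.cos φ : ℂ)⁻¹ := by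
    exact Continuous.inv₀ (by fun_prop) (quadratic_cos_ne_zero hζ)
  have hsplit := intervalIntegral.integral_add_adjacent_intervals
    (hcont.intervalIntegrable (μ := volume) 0 Real.pi)
    (hcont.intervalIntegrable Real.pi (2 * Real.pi))
  have hsymm := intervalIntegral.integral_comp_sub_left (a := 0) (b := Real.pi)
    (fun φ : ℝ => (1 + ζ ^ 2 - 2 * ζ * Real.cos φ : ℂ)⁻¹) (2 * Real.pi)
  rw [sub_zero, show 2 * Real.pi - Real.pi = Real.pi by ring] at hsymm
  simp only [Real.cos_two_pi_sub] at hsymm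
  rw [← hsymm, hint, ← two_mul] at hsplit
  linear_combination hsplit / 2

/-- The Cauchy transform of the semicircle density `√((q - y)(y - p))`. -/
theorem cauchyInt_semicircle {p q : ℝ} (hpq : p < q) {z A B : ℂ} (hA : A ^ 2 = z - p)
    (hB : B ^ 2 = q - z) (hAB : 0 < (A * (starRingEnd ℂ) B).im) :
    cauchyInt (fun y => √((q - y) * (y - p))) p q z =
      Real.pi * (z - (p + q) / 2 - I * (A * B)) := by
  set R : ℝ := (q - p) / 2 with hRdef
  have hR : 0 < R := by rw [hRdef]; linarith
  have hprod : (A - I * B) * (A + I * B) = 2 * R := by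
    have : (A - I * B) * (A + I * B) = A ^ 2 - I ^ 2 * B ^ 2 := by ring
    rw [this, I_sq, hA, hB, hRdef]
    push_cast
    ring
  have hRc : (R : ℂ) ≠ 0 := by exact_mod_cast hR.ne'
  have h2R : (2 * R : ℂ) ≠ 0 := mul_ne_zero two_ne_zero hRc
  have hm0 : A - I * B ≠ 0 := fun h => h2R (by rw [← hprod, h, zero_mul])
  have hp0 : A + I * B ≠ 0 := fun h => h2R (by rw [← hprod, h, mul_zero])
  set ζ : ℂ := (A - I * B) / (A + I * B) with hζdef
  have hζ0 : ζ ≠ 0 := div_ne_zero hm0 hp0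
  have hζ : ‖ζ‖ < 1 := by
    rw [hζdef, norm_div, div_lt_one (norm_pos_iff.2 hp0)]
    refine lt_of_pow_lt_pow_left₀ 2 (norm_nonneg _) ?_
    rw [← Complex.normSq_eq_norm_sq, ← Complex.normSq_eq_norm_sq, normSq_apply, normSq_apply]
    simp at hAB ⊢
    nlinarith
  have hRζ : R * ζ = z - (p + q) / 2 - I * (A * B) := by
    have h1 : (R : ℂ) * ζ = (A - I * B) ^ 2 / 2 := by
      rw [hζdef]
      field_simp
      linear_combination -hprod
    rw [h1]
    linear_combination (1 / 2) * hA - (1 / 2) * hB + B ^ 2 / 2 * I_sq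
  have hzζ : 2 * ζ * (z - (p + q) / 2) = R * (1 + ζ ^ 2) := by
    have h1 : (R : ℂ) * ζ = (A - I * B) ^ 2 / 2 := by
      rw [hRζ]
      linear_combination -(1 / 2) * hA + (1 / 2) * hB - B ^ 2 / 2 * I_sq
    have h2 : (R : ℂ) = (A + I * B) ^ 2 / 2 * ζ := by
      rw [hζdef]
      field_simp
      linear_combination -hprod
    linear_combination 2 * ζ * ((-1 / 2) * hA + (1 / 2) * hB - B ^ 2 / 2 * I_sq) - h2 - ζ * h1
  have hsub : ∀ φ : ℝ, z - ((p + q) / 2 + R * Real.cos φ : ℝ) =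
      R * (1 + ζ ^ 2 - 2 * ζ * Real.cos φ) / (2 * ζ) := by
    intro φ
    field_simp
    push_cast
    linear_combination hzζ
  rw [← hRζ, cauchyInt, ← integral_Ioc_eq_integral_Ioo, ← intervalIntegral.integral_of_le hpq.le]
  let c : ℝ → ℝ := fun φ => (p + q) / 2 + R * Real.cos φ
  have hc : ∀ φ, HasDerivAt c (R * -Real.sin φ) φ := fun φ =>
    ((Real.hasDerivAt_cos φ).const_mul R).const_add _
  have hc0 : c 0 = q := by simp [c, hRdef]; ring
  have hcπ : c Real.pi = p := by simp [c, hRdef]; ring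
  have hcv := intervalIntegral.integral_deriv_smul_comp'' (a := 0) (b := Real.pi) (f := c)
    (f' := fun φ => R * -Real.sin φ)
    (g := fun y : ℝ => (√((q - y) * (y - p)) : ℂ) * (z - y)⁻¹)
    (fun φ _ => (hc φ).continuousAt.continuousWithinAt)
    (fun φ _ => (hc φ).hasDerivWithinAt) (by fun_prop) ?_
  · rw [hc0, hcπ, intervalIntegral.integral_symm p q] at hcv
    rw [← neg_eq_iff_eq_neg.2 hcv, ← intervalIntegral.integral_neg]
    have hcongr : ∀ φ ∈ Set.uIcc 0 Real.pi, -((R * -Real.sin φ) •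
        ((fun y : ℝ => (√((q - y) * (y - p)) : ℂ) * (z - y)⁻¹) ∘ c) φ) =
        R / (2 * ζ) * ((1 + ζ ^ 2) + 2 * ζ * Real.cos φ
          - (1 - ζ ^ 2) ^ 2 * (1 + ζ ^ 2 - 2 * ζ * Real.cos φ : ℂ)⁻¹) := by
      intro φ hφ
      rw [Set.uIcc_of_le Real.pi_nonneg] at hφ
      have hs : 0 ≤ Real.sin φ := Real.sin_nonneg_of_nonneg_of_le_pi hφ.1 hφ.2
      have h1 : (q - c φ) * (c φ - p) = (R * Real.sin φ) ^ 2 := by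
        rw [mul_pow, Real.sin_sq]
        simp only [c, hRdef]
        ring
      have h2 := quadratic_cos_ne_zero hζ φ
      have h3 : (Real.sin φ : ℂ) ^ 2 = 1 - (Real.cos φ : ℂ) ^ 2 := by
        have := Real.sin_sq φ
        exact_mod_cast this
      simp only [Function.comp, h1, Real.sqrt_sq (mul_nonneg hR.le hs)]
      rw [show z - (c φ : ℂ) = _ from hsub φ, Complex.real_smul]
      push_cast at h2 h3 ⊢
      rw [mul_comm (2 : ℂ) ζ] at h2
      field_simp
      rw [h3]
      ring
    rw [intervalIntegral.integral_congr hcongr, intervalIntegral.integral_const_mul,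
      intervalIntegral.integral_sub, intervalIntegral.integral_add,
      intervalIntegral.integral_const_mul, intervalIntegral.integral_const_mul,
      integral_inv_quadratic_cos hζ, intervalIntegral.integral_ofReal]
    · have h4 : (1 - ζ ^ 2 : ℂ) ≠ 0 := by
        rw [pow_two]
        exact one_sub_mul_ne_zero hζ hζ.le
      simp
      field_simp
      ring
    · exact Continuous.intervalIntegrable (by fun_prop) _ _
    · exact Continuous.intervalIntegrable (by fun_prop) _ _
    · exact Continuous.intervalIntegrable (by fun_prop) _ _
    · refine Continuous.intervalIntegrable (continuous_const.mul ?_) _ _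
      exact Continuous.inv₀ (by fun_prop) (quadratic_cos_ne_zero hζ)
  · rintro _ ⟨φ, -, rfl⟩
    refine ContinuousAt.continuousWithinAt ?_
    refine ContinuousAt.mul (by fun_prop) (ContinuousAt.inv₀ (by fun_prop) ?_)
    rw [show z - (c φ : ℂ) = _ from hsub φ]
    exact div_ne_zero (mul_ne_zero hRc (quadratic_cos_ne_zero hζ φ)) (mul_ne_zero two_ne_zero hζ0)

theorem Complex.sqrt_sq' (w : ℂ) : Complex.sqrt w ^ 2 = w := by
  rw [Complex.sqrt]
  exact_mod_cast Complex.cpow_nat_inv_pow w two_ne_zero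

theorem Complex.re_sqrt_pos {w : ℂ} (hw : w ∈ slitPlane) : 0 < (Complex.sqrt w).re := by
  have h0 : w ≠ 0 := slitPlane_ne_zero hw
  have harg : |w.arg / 2| < Real.pi / 2 := by
    rw [abs_div, abs_two]
    have := abs_lt.2 ⟨Complex.neg_pi_lt_arg w,
      lt_of_le_of_ne (Complex.arg_le_pi w) (mem_slitPlane_iff_arg.1 hw).1⟩
    linarith
  rw [_root_.sqrt_eq_exp h0, Complex.exp_re]
  refine mul_pos (Real.exp_pos _) (Real.cos_pos_of_mem_Ioo ?_)
  rw [abs_lt] at harg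
  have : (Complex.log w / 2).im = w.arg / 2 := by
    rw [← Complex.log_im]
    simp
  rw [this]
  exact ⟨by linarith [harg.1], harg.2⟩

theorem Complex.im_eq_two_mul_sqrt (w : ℂ) :
    w.im = 2 * ((Complex.sqrt w).re * (Complex.sqrt w).im) := by
  have := congrArg Complex.im (Complex.sqrt_sq' w)
  rw [← this, pow_two, Complex.mul_im]
  ring

theorem Complex.re_eq_sqrt (w : ℂ) :
    w.re = (Complex.sqrt w).re ^ 2 - (Complex.sqrt w).im ^ 2 := by
  have := congrArg Complex.re (Complex.sqrt_sq' w)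
  rw [← this, pow_two, Complex.mul_re]
  ring

theorem Complex.im_sqrt_pos {w : ℂ} (hw : 0 < w.im) : 0 < (Complex.sqrt w).im := by
  have h1 := Complex.re_sqrt_pos (Or.inr hw.ne')
  have h2 := Complex.im_eq_two_mul_sqrt w
  by_contra! h
  nlinarith

theorem Complex.im_sqrt_neg {w : ℂ} (hw : w.im < 0) : (Complex.sqrt w).im < 0 := by
  have h1 := Complex.re_sqrt_pos (Or.inr hw.ne)
  have h2 := Complex.im_eq_two_mul_sqrt w
  by_contra! h
  nlinarith

theorem Complex.sqrt_neg_of_im_pos {w : ℂ} (hw : 0 < w.im) :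
    Complex.sqrt (-w) = -I * Complex.sqrt w := by
  have h1 : Complex.sqrt (-w) ^ 2 = (-I * Complex.sqrt w) ^ 2 := by
    rw [Complex.sqrt_sq', mul_pow, Complex.sqrt_sq', neg_sq, I_sq]
    ring
  refine (sq_eq_sq_iff_eq_or_eq_neg.1 h1).resolve_right fun h => ?_
  have h2 := Complex.re_sqrt_pos (w := -w) (Or.inr (by simpa using hw.ne'))
  have h3 := Complex.im_sqrt_pos hw
  rw [h] at h2
  simp at h2
  linarith

theorem Complex.sqrt_mul_of_re_pos {X Y : ℂ} (hX : 0 < X.re) (hY : 0 < Y.im)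
    (hXY : 0 < (X * Y).im) : Complex.sqrt (X * Y) = Complex.sqrt X * Complex.sqrt Y := by
  have h1 : Complex.sqrt (X * Y) ^ 2 = (Complex.sqrt X * Complex.sqrt Y) ^ 2 := by
    rw [Complex.sqrt_sq', mul_pow, Complex.sqrt_sq', Complex.sqrt_sq']
  refine (sq_eq_sq_iff_eq_or_eq_neg.1 h1).resolve_right fun h => ?_
  have a1 := Complex.re_sqrt_pos (w := X) (Or.inl hX)
  have a2 := Complex.re_eq_sqrt X
  have c1 := Complex.re_sqrt_pos (Or.inr hY.ne')
  have c2 := Complex.im_sqrt_pos hY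
  have d1 := Complex.re_sqrt_pos (Or.inr hXY.ne')
  have d2 := Complex.im_sqrt_pos hXY
  rw [h] at d1 d2
  simp only [Complex.neg_re, Complex.neg_im, Complex.mul_re, Complex.mul_im] at d1 d2
  set a := (Complex.sqrt X).re
  set b := (Complex.sqrt X).im
  set c := (Complex.sqrt Y).re
  set d := (Complex.sqrt Y).im
  have hab : |b| < a := by
    refine lt_of_pow_lt_pow_left₀ 2 a1.le ?_
    rw [sq_abs]
    linarith
  rw [abs_lt] at hab
  nlinarith [mul_pos (sub_pos.2 hab.2) c2, mul_pos (by linarith [hab.1] : 0 < a + b) c1]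

/-- Parameters of the density `√((qᵗ - yᵗ)(yᵗ - pᵗ)) · Σ_k β_k y^{-e_k}` on `(p, q)`. -/
structure PowerData (N : ℕ) where
  /-- left endpoint -/
  p : ℝ
  /-- right endpoint -/
  q : ℝ
  /-- exponent -/
  t : ℝ
  /-- coefficients -/
  β : Fin N → ℝ
  /-- exponents of the power terms -/
  e : Fin N → ℝ
  p_pos : 0 < p
  p_lt_q : p < q
  t_pos : 0 < t
  t_le_one : t ≤ 1
  β_pos : ∀ k, 0 < β k
  one_le_e : ∀ k, 1 ≤ e k
  e_le : ∀ k, e k ≤ 1 + t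

namespace PowerData

variable {N : ℕ} (P : PowerData N)

theorem q_pos : 0 < P.q := P.p_pos.trans P.p_lt_q

/-- The sum of the power terms. -/
noncomputable def powSum (z : ℂ) : ℂ := ∑ k, (P.β k : ℂ) * z ^ (-(P.e k : ℂ))

/-- The density. -/
noncomputable def density (y : ℝ) : ℝ :=
  √((P.q ^ P.t - y ^ P.t) * (y ^ P.t - P.p ^ P.t)) * ∑ k, P.β k * y ^ (-P.e k)

/-- The Cauchy transform of the density. -/
noncomputable def G : ℂ → ℂ := cauchyInt P.density P.p P.q

/-- The jump of the Cauchy transform across `(p, q)`, continued to the lower half-plane. -/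
noncomputable def jump (z : ℂ) : ℂ :=
  2 * Real.pi * Complex.sqrt ((P.q ^ P.t : ℝ) - z ^ (P.t : ℂ)) *
    Complex.sqrt ((P.p ^ P.t : ℝ) - z ^ (P.t : ℂ)) * P.powSum z

/-- The difference quotient of `z ↦ zᵗ` at `c`. -/
noncomputable def quot (c : ℝ) : ℂ → ℂ := dslope (fun z => z ^ (P.t : ℂ)) c

/-- The density divided by the semicircle density, as a holomorphic function. -/
noncomputable def weight (z : ℂ) : ℂ :=
  Complex.sqrt (P.quot P.p z) * Complex.sqrt (P.quot P.q z) * P.powSum z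

/-- The holomorphic remainder left after splitting off the semicircle part. -/
noncomputable def remainder (z : ℂ) : ℂ :=
  ∫ y in Set.Ioo P.p P.q, (√((P.q - y) * (y - P.p)) : ℂ) * dslope P.weight y z

/-- The continuation of `G` from the upper half-plane across `(p, q)`, near the positive
real axis. -/
noncomputable def glue (z : ℂ) : ℂ :=
  P.weight z * (Real.pi * (z - (P.p + P.q) / 2 -
    I * (Complex.sqrt (z - P.p) * Complex.sqrt (P.q - z)))) - P.remainder z

/-- The continuation of `G` from the upper half-plane across `(p, q)`. -/
noncomputable def Gext (z : ℂ) : ℂ :=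
  if 0 < z.im then P.G z else if z.im < 0 then P.G z - P.jump z else P.glue z

theorem isOpen_re_pos : IsOpen {z : ℂ | 0 < z.re} := isOpen_lt continuous_const continuous_re

theorem convex_re_pos : Convex ℝ {z : ℂ | 0 < z.re} := convex_halfSpace_re_gt 0

theorem hasDerivAt_cpow {z : ℂ} (hz : 0 < z.re) :
    HasDerivAt (fun z : ℂ => z ^ (P.t : ℂ)) (P.t * z ^ (P.t - 1 : ℂ)) z := by
  have h := HasDerivAt.cpow_const (c := (P.t : ℂ)) (hasDerivAt_id z) (Or.inl hz)
  simpa using h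

theorem re_deriv_cpow_pos {z : ℂ} (hz : 0 < z.re) : 0 < (P.t * z ^ (P.t - 1 : ℂ)).re := by
  have h0 : z ≠ 0 := by
    rintro rfl
    simp at hz
  rw [Complex.re_ofReal_mul, Complex.cpow_def_of_ne_zero h0, Complex.exp_re]
  refine mul_pos P.t_pos (mul_pos (Real.exp_pos _) (Real.cos_pos_of_mem_Ioo ?_))
  have harg := (Complex.abs_arg_lt_pi_div_two_iff (z := z)).2 (Or.inl hz)
  have him : (Complex.log z * (P.t - 1 : ℂ)).im = (P.t - 1) * z.arg := by
    rw [show (P.t - 1 : ℂ) = ((P.t - 1 : ℝ) : ℂ) by push_cast; rfl, Complex.im_mul_ofReal,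
      Complex.log_im, mul_comm]
  rw [him, Set.mem_Ioo, ← abs_lt, abs_mul]
  have h1 : |P.t - 1| ≤ 1 := by
    rw [abs_le]
    constructor <;> linarith [P.t_pos, P.t_le_one]
  nlinarith [abs_nonneg z.arg, abs_nonneg (P.t - 1)]

theorem re_quot_pos {c : ℝ} (hc : 0 < c) {z : ℂ} (hz : 0 < z.re) : 0 < (P.quot c z).re := by
  rw [quot]
  by_cases h : z = c
  · rw [h, dslope_same, (P.hasDerivAt_cpow (by simpa using hc)).deriv]
    exact P.re_deriv_cpow_pos (by simpa using hc)
  · rw [dslope_of_ne _ h, slope_def_field]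
    have := re_mul_slope_pos (c := 1) convex_re_pos (fun z hz => P.hasDerivAt_cpow hz)
      (fun z hz => by rw [one_mul]; exact P.re_deriv_cpow_pos hz)
      (show (c : ℂ) ∈ {z : ℂ | 0 < z.re} by simpa using hc) hz (Ne.symm h)
    simpa using this

theorem quot_differentiableOn {c : ℝ} (hc : 0 < c) :
    DifferentiableOn ℂ (P.quot c) {z | 0 < z.re} := by
  refine (Complex.differentiableOn_dslope (isOpen_re_pos.mem_nhds
    (show (c : ℂ) ∈ {z : ℂ | 0 < z.re} by simpa using hc))).2 fun z hz => ?_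
  exact (P.hasDerivAt_cpow hz).differentiableAt.differentiableWithinAt

theorem powSum_differentiableAt {z : ℂ} (hz : z ∈ slitPlane) :
    DifferentiableAt ℂ P.powSum z := by
  refine DifferentiableAt.fun_sum fun k _ => DifferentiableAt.const_mul ?_ _
  exact DifferentiableAt.cpow_const differentiableAt_id hz

theorem weight_differentiableOn : DifferentiableOn ℂ P.weight {z | 0 < z.re} := by
  have hs : ∀ {c : ℝ}, 0 < c →
      DifferentiableOn ℂ (fun z => Complex.sqrt (P.quot c z)) {z | 0 < z.re} := fun {c} hc =>
    Complex.differentiableOn_sqrt.comp (P.quot_differentiableOn hc)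
      fun z hz => Or.inl (P.re_quot_pos hc hz)
  refine ((hs P.p_pos).mul (hs P.q_pos)).mul fun z hz => ?_
  exact (P.powSum_differentiableAt (Or.inl hz)).differentiableWithinAt

end PowerData

theorem Complex.sqrt_ofReal_of_nonneg {x : ℝ} (hx : 0 ≤ x) :
    Complex.sqrt (x : ℂ) = (√x : ℝ) := by
  rw [Complex.sqrt, Real.sqrt_eq_rpow, Complex.ofReal_cpow hx]
  norm_num

namespace PowerData

variable {N : ℕ} (P : PowerData N)

theorem powSum_ofReal {y : ℝ} (hy : 0 ≤ y) :
    P.powSum y = (∑ k, P.β k * y ^ (-P.e k) : ℝ) := by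
  rw [powSum]
  push_cast [Complex.ofReal_cpow hy]
  rfl

theorem powSum_pos (hN : 0 < N) {y : ℝ} (hy : 0 < y) : 0 < ∑ k, P.β k * y ^ (-P.e k) :=
  Finset.sum_pos (fun k _ => mul_pos (P.β_pos k) (Real.rpow_pos_of_pos hy _))
    ⟨⟨0, hN⟩, Finset.mem_univ _⟩

theorem quot_ofReal {c y : ℝ} (hc : 0 ≤ c) (hy : 0 ≤ y) (h : y ≠ c) :
    P.quot c y = ((y ^ P.t - c ^ P.t) / (y - c) : ℝ) := by
  rw [quot, dslope_of_ne _ (by exact_mod_cast h), slope_def_field]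
  push_cast [Complex.ofReal_cpow hc, Complex.ofReal_cpow hy]
  rfl

theorem ofReal_quot_nonneg {c y : ℝ} (hc : 0 ≤ c) (hy : 0 ≤ y) :
    0 ≤ (y ^ P.t - c ^ P.t) / (y - c) := by
  rcases le_total y c with h | h
  · exact div_nonneg_of_nonpos (sub_nonpos.2 (Real.rpow_le_rpow hy h P.t_pos.le))
      (sub_nonpos.2 h)
  · exact div_nonneg (sub_nonneg.2 (Real.rpow_le_rpow hc h P.t_pos.le)) (sub_nonneg.2 h)

theorem weight_ofReal {y : ℝ} (hy : 0 < y) (hp : y ≠ P.p) (hq : y ≠ P.q) :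
    P.weight y = (√((y ^ P.t - P.p ^ P.t) / (y - P.p)) * √((y ^ P.t - P.q ^ P.t) / (y - P.q)) *
      ∑ k, P.β k * y ^ (-P.e k) : ℝ) := by
  rw [weight, P.quot_ofReal P.p_pos.le hy.le hp, P.quot_ofReal P.q_pos.le hy.le hq,
    P.powSum_ofReal hy.le, Complex.sqrt_ofReal_of_nonneg (P.ofReal_quot_nonneg P.p_pos.le hy.le),
    Complex.sqrt_ofReal_of_nonneg (P.ofReal_quot_nonneg P.q_pos.le hy.le)]
  push_cast
  rfl

theorem weight_continuousAt {y : ℝ} (hy : 0 < y) : ContinuousAt P.weight y :=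
  (P.weight_differentiableOn.differentiableAt
    (isOpen_re_pos.mem_nhds (show (y : ℂ) ∈ {z : ℂ | 0 < z.re} by simpa using hy))).continuousAt

theorem weight_im_ofReal {y : ℝ} (hy : 0 < y) : (P.weight y).im = 0 := by
  have h1 : Tendsto (fun x : ℝ => (P.weight x).im) (𝓝[{P.p, P.q}ᶜ ∩ Set.Ioi 0] y)
      (𝓝 (P.weight y).im) := by
    have h2 : ContinuousAt (fun x : ℝ => (P.weight x).im) y :=
      continuous_im.continuousAt.comp
        (ContinuousAt.comp (f := Complex.ofReal) (P.weight_continuousAt hy)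
          continuous_ofReal.continuousAt)
    exact h2.tendsto.mono_left nhdsWithin_le_nhds
  have h3 : Tendsto (fun x : ℝ => (P.weight x).im) (𝓝[{P.p, P.q}ᶜ ∩ Set.Ioi 0] y) (𝓝 0) := by
    refine tendsto_const_nhds.congr' ?_
    filter_upwards [self_mem_nhdsWithin] with x hx
    have hx1 := hx.1
    simp only [Set.mem_compl_iff, Set.mem_insert_iff, Set.mem_singleton_iff, not_or] at hx1
    rw [P.weight_ofReal hx.2 hx1.1 hx1.2, ofReal_im]
  have hne : (𝓝[{P.p, P.q}ᶜ ∩ Set.Ioi 0] y).NeBot := by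
    rw [← mem_closure_iff_nhdsWithin_neBot, Set.inter_comm]
    have hd : Dense ({P.p, P.q}ᶜ : Set ℝ) := (Set.toFinite {P.p, P.q}).countable.dense_compl ℝ
    exact hd.open_subset_closure_inter isOpen_Ioi hy
  exact tendsto_nhds_unique h1 h3

theorem weight_mul_semicircle {y : ℝ} (hy : y ∈ Set.Ioo P.p P.q) :
    P.weight y * (√((P.q - y) * (y - P.p)) : ℝ) = P.density y := by
  have hy0 : 0 < y := P.p_pos.trans hy.1
  have h1 : 0 < y - P.p := sub_pos.2 hy.1
  have h2 : 0 < P.q - y := sub_pos.2 hy.2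
  rw [P.weight_ofReal hy0 hy.1.ne' hy.2.ne, ← ofReal_mul, density]
  congr 1
  have h3 : (y ^ P.t - P.p ^ P.t) / (y - P.p) * ((y ^ P.t - P.q ^ P.t) / (y - P.q)) *
      ((P.q - y) * (y - P.p)) = (P.q ^ P.t - y ^ P.t) * (y ^ P.t - P.p ^ P.t) := by
    have h4 : y - P.q ≠ 0 := by linarith
    field_simp
    ring
  rw [← h3, Real.sqrt_mul (mul_nonneg (P.ofReal_quot_nonneg P.p_pos.le hy0.le)
    (P.ofReal_quot_nonneg P.q_pos.le hy0.le)),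
    Real.sqrt_mul (P.ofReal_quot_nonneg P.p_pos.le hy0.le)]
  ring

theorem weight_continuousOn_ofReal :
    ContinuousOn (fun y : ℝ => P.weight y) (Set.Ioo P.p P.q) := fun _ hy =>
  (ContinuousAt.comp (f := Complex.ofReal) (P.weight_continuousAt (P.p_pos.trans hy.1))
    continuous_ofReal.continuousAt).continuousWithinAt

theorem ofReal_mem_re_pos {y : ℝ} (hy : y ∈ Set.Icc P.p P.q) : (y : ℂ) ∈ {z : ℂ | 0 < z.re} := by
  simpa using P.p_pos.trans_le hy.1

/-- A compact convex subset of the right half-plane. -/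
theorem exists_compact_convex {z₀ : ℂ} {r : ℝ} (hrz : r < z₀.re) :
    ∃ K : Set ℂ, IsCompact K ∧ Convex ℝ K ∧ K ⊆ {z | 0 < z.re} ∧ Metric.closedBall z₀ r ⊆ K ∧
      Complex.ofReal '' Set.Icc P.p P.q ⊆ K := by
  refine ⟨Metric.closedBall 0 (max (‖z₀‖ + r) P.q) ∩ {z | min P.p (z₀.re - r) ≤ z.re},
    (isCompact_closedBall _ _).inter_right (isClosed_le continuous_const continuous_re),
    (convex_closedBall _ _).inter (convex_halfSpace_re_ge _), ?_, ?_, ?_⟩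
  · rintro z ⟨-, hz⟩
    exact (lt_min P.p_pos (sub_pos.2 hrz)).trans_le hz
  · intro z hz
    rw [Metric.mem_closedBall, dist_eq_norm] at hz
    refine ⟨?_, ?_⟩
    · rw [mem_closedBall_zero_iff]
      refine le_max_of_le_left ?_
      have := norm_sub_norm_le z z₀
      linarith
    · have h1 := (Complex.abs_re_le_norm (z - z₀)).trans hz
      rw [Complex.sub_re, abs_le] at h1
      exact (min_le_right _ _).trans (show z₀.re - r ≤ z.re by linarith [h1.1])
  · rintro _ ⟨y, hy, rfl⟩
    refine ⟨?_, ?_⟩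
    · rw [mem_closedBall_zero_iff, Complex.norm_real, Real.norm_eq_abs,
        abs_of_pos (P.p_pos.trans_le hy.1)]
      exact le_max_of_le_right hy.2
    · exact (min_le_left _ _).trans (by simpa using hy.1)

theorem remainder_integrand_aestronglyMeasurable (z : ℂ) :
    AEStronglyMeasurable (fun y : ℝ => (√((P.q - y) * (y - P.p)) : ℂ) * dslope P.weight y z)
      (volume.restrict (Set.Ioo P.p P.q)) := by
  have h1 : AEStronglyMeasurable (fun y : ℝ => (√((P.q - y) * (y - P.p)) : ℂ) *
      ((P.weight z - P.weight y) * (z - y)⁻¹)) (volume.restrict (Set.Ioo P.p P.q)) := by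
    refine AEStronglyMeasurable.mul
      (by fun_prop : Continuous fun y : ℝ => (√((P.q - y) * (y - P.p)) : ℂ)).aestronglyMeasurable
      (AEStronglyMeasurable.mul (aestronglyMeasurable_const.sub
        (P.weight_continuousOn_ofReal.aestronglyMeasurable measurableSet_Ioo))
      (by fun_prop : Measurable fun y : ℝ => (z - y : ℂ)⁻¹).aestronglyMeasurable)
  refine h1.congr ?_
  have h2 : ∀ᵐ y ∂(volume.restrict (Set.Ioo P.p P.q)), y ≠ z.re :=
    ae_restrict_of_ae (Measure.ae_ne volume z.re)
  filter_upwards [h2] with y hy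
  have hzy : z ≠ y := fun h => hy (by rw [h, ofReal_re])
  rw [dslope_of_ne _ hzy, slope_def_field, div_eq_mul_inv]

theorem remainder_differentiableOn : DifferentiableOn ℂ P.remainder {z | 0 < z.re} := by
  refine differentiableOn_integral_of_locally_dominated ?_
    (fun z _ => P.remainder_integrand_aestronglyMeasurable z) ?_
  · refine (ae_restrict_mem measurableSet_Ioo).mono fun y hy => ?_
    refine DifferentiableOn.const_mul ?_ _
    exact (Complex.differentiableOn_dslope (isOpen_re_pos.mem_nhds
      (P.ofReal_mem_re_pos (Set.Ioo_subset_Icc_self hy)))).2 P.weight_differentiableOn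
  · intro z₀ hz₀
    have hz₀' : 0 < z₀.re := hz₀
    obtain ⟨K, hK, hKc, hKV, hKb, hKI⟩ := P.exists_compact_convex (z₀ := z₀) (r := z₀.re / 2)
      (by linarith)
    have hder : ContinuousOn (deriv P.weight) K :=
      ((P.weight_differentiableOn.deriv isOpen_re_pos).continuousOn).mono hKV
    obtain ⟨C, hC⟩ := hK.exists_bound_of_continuousOn hder
    refine ⟨z₀.re / 2, by positivity, hKb.trans hKV,
      fun y => √((P.q - y) * (y - P.p)) * C, ?_, ?_⟩
    · refine Integrable.mul_const ?_ _
      have : Continuous fun y => √((P.q - y) * (y - P.p)) := by fun_prop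
      exact (this.integrableOn_Icc (a := P.p) (b := P.q)).mono_set Set.Ioo_subset_Icc_self
    · refine (ae_restrict_mem measurableSet_Ioo).mono fun y hy z hz => ?_
      rw [norm_mul, Complex.norm_real, Real.norm_eq_abs, abs_of_nonneg (Real.sqrt_nonneg _)]
      refine mul_le_mul_of_nonneg_left ?_ (Real.sqrt_nonneg _)
      have hyK : (y : ℂ) ∈ K := hKI ⟨y, Set.Ioo_subset_Icc_self hy, rfl⟩
      by_cases hzy : z = y
      · rw [hzy, dslope_same]
        exact hC _ hyK
      · rw [dslope_of_ne _ hzy, slope_def_field, norm_div,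
          div_le_iff₀ (norm_pos_iff.2 (sub_ne_zero.2 hzy))]
        exact hKc.norm_image_sub_le_of_norm_deriv_le
          (fun v hv => P.weight_differentiableOn.differentiableAt
            (isOpen_re_pos.mem_nhds (hKV hv))) hC hyK (hKb hz)

theorem density_integrableOn : IntegrableOn P.density (Set.Ioo P.p P.q) := by
  have : ContinuousOn P.density (Set.Icc P.p P.q) := by
    have hne : ∀ y ∈ Set.Icc P.p P.q, y ≠ 0 := fun y hy => (P.p_pos.trans_le hy.1).ne'
    have hr : ∀ s : ℝ, ContinuousOn (fun y : ℝ => y ^ s) (Set.Icc P.p P.q) := fun s =>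
      continuousOn_id.rpow_const fun y hy => Or.inl (hne y hy)
    unfold density
    refine ContinuousOn.mul (Real.continuous_sqrt.comp_continuousOn ?_) ?_
    · exact (continuousOn_const.sub (hr _)).mul ((hr _).sub continuousOn_const)
    · exact continuousOn_finsetSum _ fun k _ => continuousOn_const.mul (hr _)
  exact (this.integrableOn_compact isCompact_Icc).mono_set Set.Ioo_subset_Icc_self

theorem density_pos (hN : 0 < N) {y : ℝ} (hy : y ∈ Set.Ioo P.p P.q) : 0 < P.density y := by
  have hy0 : 0 < y := P.p_pos.trans hy.1
  refine mul_pos (Real.sqrt_pos.2 (mul_pos ?_ ?_)) (P.powSum_pos hN hy0)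
  · exact sub_pos.2 (Real.rpow_lt_rpow hy0.le hy.2 P.t_pos)
  · exact sub_pos.2 (Real.rpow_lt_rpow P.p_pos.le hy.1 P.t_pos)

/-- Splitting off the semicircle part of the Cauchy transform. -/
theorem G_eq_weight_mul_sub {z : ℂ} (hz : z.im ≠ 0) :
    P.G z = P.weight z * cauchyInt (fun y => √((P.q - y) * (y - P.p))) P.p P.q z -
      P.remainder z := by
  have hne : ∀ y : ℝ, z ≠ y := fun y h => hz (by rw [h, ofReal_im])
  have hw : IntegrableOn (fun y => √((P.q - y) * (y - P.p))) (Set.Ioo P.p P.q) := by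
    have : Continuous fun y => √((P.q - y) * (y - P.p)) := by fun_prop
    exact (this.integrableOn_Icc (a := P.p) (b := P.q)).mono_set Set.Ioo_subset_Icc_self
  have h1 := (cauchyInt_integrable hw hz).const_mul (P.weight z)
  have h2 := cauchyInt_integrable P.density_integrableOn hz
  have hpt : ∀ y ∈ Set.Ioo P.p P.q, (√((P.q - y) * (y - P.p)) : ℂ) * dslope P.weight y z =
      P.weight z * ((√((P.q - y) * (y - P.p)) : ℂ) * (z - y)⁻¹) -
        (P.density y : ℂ) * (z - y)⁻¹ := by
    intro y hy
    rw [← P.weight_mul_semicircle hy, dslope_of_ne _ (hne y), slope_def_field, div_eq_mul_inv]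
    ring
  have h3 : P.remainder z = P.weight z *
      cauchyInt (fun y => √((P.q - y) * (y - P.p))) P.p P.q z - P.G z := by
    rw [remainder, setIntegral_congr_fun measurableSet_Ioo hpt, integral_sub h1 h2,
      integral_const_mul]
    rfl
  rw [h3]
  ring

theorem glue_eq_of_im_pos {z : ℂ} (hz : 0 < z.im) : P.glue z = P.G z := by
  rw [P.G_eq_weight_mul_sub hz.ne', glue, cauchyInt_semicircle P.p_lt_q
    (A := Complex.sqrt (z - P.p)) (B := Complex.sqrt (P.q - z)) (Complex.sqrt_sq' _)
    (Complex.sqrt_sq' _)]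
  have h1 := Complex.im_sqrt_pos (w := z - P.p) (by simpa using hz)
  have h2 := Complex.re_sqrt_pos (w := z - P.p) (Or.inr (by simpa using hz.ne'))
  have h3 := Complex.im_sqrt_neg (w := P.q - z) (by simpa using hz)
  have h4 := Complex.re_sqrt_pos (w := P.q - z) (Or.inr (by simpa using hz.ne'))
  simp only [Complex.mul_im, Complex.conj_re, Complex.conj_im]
  nlinarith [mul_pos h1 h4, mul_pos h2 (neg_pos.2 h3)]

theorem cpow_im_neg {z : ℂ} (hz : z.im < 0) : (z ^ (P.t : ℂ)).im < 0 := by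
  have h0 : z ≠ 0 := by
    rintro rfl
    simp at hz
  have h1 : z.arg < 0 := Complex.arg_neg_iff.2 hz
  have h2 := Complex.neg_pi_lt_arg z
  rw [Complex.cpow_def_of_ne_zero h0, Complex.exp_im, Complex.im_mul_ofReal, Complex.log_im]
  refine mul_neg_of_pos_of_neg (Real.exp_pos _) (Real.sin_neg_of_neg_of_neg_pi_lt ?_ ?_)
  · exact mul_neg_of_neg_of_pos h1 P.t_pos
  · nlinarith [P.t_pos, P.t_le_one]

theorem sqrt_sub_cpow {c : ℝ} (hc : 0 < c) {z : ℂ} (hz : z.im < 0) (hz' : 0 < z.re) :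
    Complex.sqrt ((c ^ P.t : ℝ) - z ^ (P.t : ℂ)) =
      Complex.sqrt (P.quot c z) * Complex.sqrt (c - z) := by
  have h1 : P.quot c z * (c - z) = (c ^ P.t : ℝ) - z ^ (P.t : ℂ) := by
    have hzc : z ≠ c := fun h => hz.ne (by rw [h, ofReal_im])
    have := sub_ne_zero.2 hzc
    rw [quot, dslope_of_ne _ hzc, slope_def_field, Complex.ofReal_cpow hc.le]
    field_simp
    ring
  rw [← h1]
  refine Complex.sqrt_mul_of_re_pos (P.re_quot_pos hc hz') (by simpa using hz) ?_
  rw [h1]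
  simpa using P.cpow_im_neg hz

theorem glue_eq_of_im_neg {z : ℂ} (hz : z.im < 0) (hz' : 0 < z.re) :
    P.glue z = P.G z - P.jump z := by
  rw [P.G_eq_weight_mul_sub hz.ne, glue, cauchyInt_semicircle P.p_lt_q
    (A := Complex.sqrt (z - P.p)) (B := -Complex.sqrt (P.q - z)) (Complex.sqrt_sq' _)
    (by rw [neg_sq, Complex.sqrt_sq']), jump, P.sqrt_sub_cpow P.p_pos hz hz',
    P.sqrt_sub_cpow P.q_pos hz hz', weight, ← neg_sub (P.p : ℂ) z,
    Complex.sqrt_neg_of_im_pos (by simpa using hz)]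
  · linear_combination (2 * Real.pi * Complex.sqrt (P.quot P.p z) * Complex.sqrt (P.quot P.q z) *
      P.powSum z * Complex.sqrt (P.p - z) * Complex.sqrt (P.q - z)) * I_sq
  have h1 := Complex.im_sqrt_neg (w := z - P.p) (by simpa using hz)
  have h2 := Complex.re_sqrt_pos (w := z - P.p) (Or.inr (by simpa using hz.ne))
  have h3 := Complex.im_sqrt_pos (w := P.q - z) (by simpa using hz)
  have h4 := Complex.re_sqrt_pos (w := P.q - z) (Or.inr (by simpa using hz.ne))
  simp only [Complex.mul_im, Complex.conj_re, Complex.conj_im, map_neg, Complex.neg_re,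
    Complex.neg_im]
  nlinarith [mul_pos h2 h3, mul_pos (neg_pos.2 h1) h4]

/-- The domain of the continued Cauchy transform. -/
def domain : Set ℂ := {z | z.im = 0 → z.re ∈ Set.Ioo P.p P.q}

theorem Gext_eq_glue {z : ℂ} (hz : 0 < z.re) : P.Gext z = P.glue z := by
  rw [Gext]
  split_ifs with h1 h2
  · exact (P.glue_eq_of_im_pos h1).symm
  · exact (P.glue_eq_of_im_neg h2 hz).symm
  · rfl

theorem isOpen_domain : IsOpen P.domain := by
  have : P.domain = {z : ℂ | z.im ≠ 0} ∪ {z : ℂ | P.p < z.re ∧ z.re < P.q} := by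
    ext z
    by_cases h : z.im = 0 <;> simp [domain, h]
  rw [this]
  exact (isOpen_ne_fun continuous_im continuous_const).union
    ((isOpen_lt continuous_const continuous_re).inter (isOpen_lt continuous_re continuous_const))

theorem G_differentiableAt {z : ℂ} (hz : z ∉ Complex.ofReal '' Set.Icc P.p P.q) :
    DifferentiableAt ℂ P.G z :=
  (cauchyInt_differentiableOn P.density_integrableOn).differentiableAt
    ((isClosed_ofReal_Icc P.p P.q).isOpen_compl.mem_nhds hz)

theorem jump_differentiableAt {z : ℂ} (hz : z.im < 0) : DifferentiableAt ℂ P.jump z := by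
  have hs : z ∈ slitPlane := Or.inr hz.ne
  have h1 : DifferentiableAt ℂ (fun z : ℂ => z ^ (P.t : ℂ)) z :=
    DifferentiableAt.cpow_const differentiableAt_id hs
  have h2 : ∀ c : ℝ, DifferentiableAt ℂ (fun z : ℂ => Complex.sqrt (c - z ^ (P.t : ℂ))) z := by
    intro c
    refine DifferentiableAt.comp z (Complex.differentiableAt_sqrt (Or.inr ?_))
      (h1.const_sub (c : ℂ))
    simpa using (P.cpow_im_neg hz).ne
  exact (((h2 _).const_mul _).mul (h2 _)).mul (P.powSum_differentiableAt hs)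

theorem glue_differentiableAt {z : ℂ} (hz : z.re ∈ Set.Ioo P.p P.q) :
    DifferentiableAt ℂ P.glue z := by
  have hz0 : 0 < z.re := P.p_pos.trans hz.1
  have hV := isOpen_re_pos.mem_nhds hz0
  have h1 : DifferentiableAt ℂ (fun z : ℂ => Complex.sqrt (z - P.p)) z :=
    DifferentiableAt.comp z (Complex.differentiableAt_sqrt (Or.inl (by simpa using hz.1)))
      (differentiableAt_id.sub_const _)
  have h2 : DifferentiableAt ℂ (fun z : ℂ => Complex.sqrt (P.q - z)) z :=
    DifferentiableAt.comp z (Complex.differentiableAt_sqrt (Or.inl (by simpa using hz.2)))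
      (differentiableAt_id.const_sub _)
  refine ((P.weight_differentiableOn.differentiableAt hV).mul (DifferentiableAt.const_mul ?_ _)).sub
    (P.remainder_differentiableOn.differentiableAt hV)
  exact (differentiableAt_id.sub_const _).sub ((h1.mul h2).const_mul _)

theorem Gext_analyticOnNhd : AnalyticOnNhd ℂ P.Gext P.domain := by
  refine DifferentiableOn.analyticOnNhd (fun z hz => DifferentiableAt.differentiableWithinAt ?_)
    P.isOpen_domain
  rcases lt_trichotomy z.im 0 with h | h | h
  · have hz' : z ∉ Complex.ofReal '' Set.Icc P.p P.q := by
      rintro ⟨y, -, rfl⟩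
      simp at h
    refine ((P.G_differentiableAt hz').sub (P.jump_differentiableAt h)).congr_of_eventuallyEq ?_
    filter_upwards [(isOpen_lt continuous_im continuous_const).mem_nhds h] with v hv
    rw [Gext, if_neg (not_lt.2 (le_of_lt hv)), if_pos (show v.im < 0 from hv)]
    rfl
  · refine (P.glue_differentiableAt (hz h)).congr_of_eventuallyEq ?_
    filter_upwards [isOpen_re_pos.mem_nhds
      (show z ∈ {z : ℂ | 0 < z.re} from P.p_pos.trans (hz h).1)] with v hv
    exact P.Gext_eq_glue hv
  · have hz' : z ∉ Complex.ofReal '' Set.Icc P.p P.q := by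
      rintro ⟨y, -, rfl⟩
      simp at h
    refine (P.G_differentiableAt hz').congr_of_eventuallyEq ?_
    filter_upwards [(isOpen_lt continuous_const continuous_im).mem_nhds h] with v hv
    rw [Gext, if_pos (show 0 < v.im from hv)]

end PowerData

/-- A function whose square tends to a nonpositive real number has real part tending to `0`. -/
theorem tendsto_re_zero_of_sq {α : Type*} {F : Filter α} {g : α → ℂ} {L : ℝ} (hL : 0 ≤ L)
    (h : Tendsto (fun x => g x ^ 2) F (𝓝 (-L : ℂ))) : Tendsto (fun x => (g x).re) F (𝓝 0) := by
  have h1 : Tendsto (fun x => √((‖g x ^ 2‖ + (g x ^ 2).re) / 2)) F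
      (𝓝 (√((‖(-L : ℂ)‖ + (-L : ℂ).re) / 2))) :=
    (Real.continuous_sqrt.tendsto _).comp
      ((h.norm.add ((continuous_re.tendsto _).comp h)).div_const 2)
  have h2 : √((‖(-L : ℂ)‖ + (-L : ℂ).re) / 2) = 0 := by
    simp [abs_of_nonneg hL]
  rw [h2] at h1
  have h3 : (fun x => √((‖g x ^ 2‖ + (g x ^ 2).re) / 2)) = fun x => |(g x).re| := by
    funext x
    rw [← Real.sqrt_sq_eq_abs, norm_pow, ← Complex.normSq_eq_norm_sq, normSq_apply, pow_two (g x),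
      Complex.mul_re]
    congr 1
    ring
  rw [h3] at h1
  exact (tendsto_zero_iff_abs_tendsto_zero _).2 h1

/-- Adding a positive real number to a number in the upper half-plane decreases the argument. -/
theorem Complex.arg_add_ofReal_mem {c ρ η : ℝ} (hc : 0 < c) (hρ : 0 < ρ) (hη : 0 ≤ η)
    (hη' : η < Real.pi) : (c + ρ * exp (η * I)) ∈ slitPlane ∧
      0 ≤ (c + ρ * exp (η * I)).arg ∧ (c + ρ * exp (η * I)).arg ≤ η := by
  set w : ℂ := c + ρ * exp (η * I) with hw
  have him : w.im = ρ * Real.sin η := by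
    rw [hw, Complex.add_im, Complex.ofReal_im, zero_add, Complex.im_ofReal_mul,
      Complex.exp_ofReal_mul_I_im]
  have hre : w.re = c + ρ * Real.cos η := by
    rw [hw, Complex.add_re, Complex.ofReal_re, Complex.re_ofReal_mul,
      Complex.exp_ofReal_mul_I_re]
  have hs : 0 ≤ Real.sin η := Real.sin_nonneg_of_nonneg_of_le_pi hη hη'.le
  have hslit : w ∈ slitPlane := by
    rcases hη.eq_or_lt with h | h
    · left
      rw [hre, ← h, Real.cos_zero]
      linarith
    · right
      rw [him]
      exact (mul_pos hρ (Real.sin_pos_of_pos_of_lt_pi h hη')).ne'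
  have harg0 : 0 ≤ w.arg := Complex.arg_nonneg_iff.2 (by rw [him]; exact mul_nonneg hρ.le hs)
  refine ⟨hslit, harg0, ?_⟩
  by_contra! h
  have hlt : w.arg < Real.pi :=
    lt_of_le_of_ne (Complex.arg_le_pi w) (mem_slitPlane_iff_arg.1 hslit).1
  have h1 : 0 < Real.sin (w.arg - η) := Real.sin_pos_of_pos_of_lt_pi (by linarith) (by linarith)
  have hn : 0 < ‖w‖ := norm_pos_iff.2 (slitPlane_ne_zero hslit)
  have h2 : ‖w‖ * Real.sin (w.arg - η) = -(c * Real.sin η) := by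
    rw [Real.sin_sub, mul_sub, ← mul_assoc, ← mul_assoc, Complex.norm_mul_sin_arg,
      Complex.norm_mul_cos_arg, him, hre]
    ring
  nlinarith [mul_pos hn h1, mul_nonneg hc.le hs]

namespace PowerData

variable {N : ℕ} (P : PowerData N)

theorem isConnected_domain : IsConnected P.domain := by
  have hpq := P.p_lt_q
  have hm : ((P.p + P.q) / 2 : ℝ) ∈ Set.Ioo P.p P.q := ⟨by linarith, by linarith⟩
  have hst : StarConvex ℝ (((P.p + P.q) / 2 : ℝ) : ℂ) P.domain := by
    intro z hz a b ha hb hab h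
    have h' : b * z.im = 0 := by simpa using h
    have hre : (a • (((P.p + P.q) / 2 : ℝ) : ℂ) + b • z).re = a * ((P.p + P.q) / 2) + b * z.re := by
      simp only [Complex.add_re, Complex.smul_re, Complex.ofReal_re, smul_eq_mul]
    rw [hre]
    rcases mul_eq_zero.1 h' with h0 | h0
    · rw [h0, show a = 1 by linarith]
      simpa using hm
    · have h1 := hz h0
      exact convex_Ioo P.p P.q hm h1 ha hb hab
  exact (hst.isPathConnected fun _ => by simpa using hm).isConnected

/-- Up to the factor `2πi` and the coefficient, a term of the jump. -/
noncomputable def jumpTerm (k : Fin N) (z : ℂ) : ℂ :=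
  -I * (Complex.sqrt ((P.q ^ P.t : ℝ) - z ^ (P.t : ℂ)) *
    Complex.sqrt ((P.p ^ P.t : ℝ) - z ^ (P.t : ℂ)) * z ^ (-(P.e k : ℂ)))

theorem jump_im (z : ℂ) : (P.jump z).im = 2 * Real.pi * ∑ k, P.β k * (P.jumpTerm k z).re := by
  have h : P.jump z = ((2 * Real.pi : ℝ) : ℂ) * (I * ∑ k, (P.β k : ℂ) * P.jumpTerm k z) := by
    rw [jump, powSum, Finset.mul_sum, Finset.mul_sum, Finset.mul_sum]
    refine Finset.sum_congr rfl fun k _ => ?_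
    rw [jumpTerm]
    push_cast
    linear_combination (2 * Real.pi * Complex.sqrt ((P.q ^ P.t : ℝ) - z ^ (P.t : ℂ)) *
      Complex.sqrt ((P.p ^ P.t : ℝ) - z ^ (P.t : ℂ)) * P.β k * z ^ (-(P.e k : ℂ))) * I_sq
  rw [h, Complex.im_ofReal_mul, Complex.I_mul_im, Complex.re_sum]
  simp only [Complex.re_ofReal_mul]

theorem jump_im_le {F : Filter ℂ}
    (h : ∀ k, ∀ ε > 0, ∀ᶠ z in F, (P.jumpTerm k z).re ≤ ε) {ε : ℝ} (hε : 0 < ε) :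
    ∀ᶠ z in F, (P.jump z).im ≤ ε := by
  have hB : 0 ≤ ∑ k, P.β k := Finset.sum_nonneg fun k _ => (P.β_pos k).le
  have hpi := Real.pi_pos
  set δ : ℝ := ε / (2 * Real.pi * (∑ k, P.β k + 1)) with hδ
  have hδ0 : 0 < δ := by positivity
  filter_upwards [eventually_all.2 fun k => h k δ hδ0] with z hz
  rw [P.jump_im]
  calc 2 * Real.pi * ∑ k, P.β k * (P.jumpTerm k z).re
      ≤ 2 * Real.pi * ∑ k, P.β k * δ := by
        gcongr with k
        · exact (P.β_pos k).le
        · exact hz k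
    _ ≤ 2 * Real.pi * ((∑ k, P.β k + 1) * δ) := by
        rw [← Finset.sum_mul]
        gcongr
        linarith
    _ = ε := by
        rw [hδ]
        field_simp

theorem jumpTerm_sq (k : Fin N) (z : ℂ) : P.jumpTerm k z ^ 2 =
    -(((P.q ^ P.t : ℝ) - z ^ (P.t : ℂ)) * ((P.p ^ P.t : ℝ) - z ^ (P.t : ℂ)) *
      (z ^ (-(P.e k : ℂ))) ^ 2) := by
  rw [jumpTerm, mul_pow, mul_pow, mul_pow, Complex.sqrt_sq', Complex.sqrt_sq', neg_sq, I_sq]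
  ring

theorem jumpTerm_of_pos (k : Fin N) {x : ℝ} (hx : 0 < x) (hxpq : x ∉ Set.Icc P.p P.q) {ε : ℝ}
    (hε : 0 < ε) : ∀ᶠ z in 𝓝 (x : ℂ), (P.jumpTerm k z).re ≤ ε := by
  have hs : (x : ℂ) ∈ slitPlane := Or.inl (by simpa using hx)
  have hc : ∀ s : ℂ, ContinuousAt (fun z : ℂ => z ^ s) x := fun s =>
    (continuousAt_id (x := (x : ℂ))).cpow continuousAt_const hs
  have h1 : ContinuousAt (fun z => P.jumpTerm k z ^ 2) (x : ℂ) := by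
    simp only [P.jumpTerm_sq]
    exact (((continuousAt_const.sub (hc _)).mul (continuousAt_const.sub (hc _))).mul
      ((hc _).pow 2)).neg
  have h2 : P.jumpTerm k x ^ 2 = -(((P.q ^ P.t - x ^ P.t) * (P.p ^ P.t - x ^ P.t) *
      (x ^ (-P.e k)) ^ 2 : ℝ) : ℂ) := by
    rw [P.jumpTerm_sq]
    push_cast [Complex.ofReal_cpow hx.le]
    rfl
  have h3 : 0 ≤ (P.q ^ P.t - x ^ P.t) * (P.p ^ P.t - x ^ P.t) := by
    rw [Set.mem_Icc, not_and_or, not_le, not_le] at hxpq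
    rcases hxpq with h | h
    · exact mul_nonneg (sub_nonneg.2 (Real.rpow_le_rpow hx.le (h.trans P.p_lt_q).le P.t_pos.le))
        (sub_nonneg.2 (Real.rpow_le_rpow hx.le h.le P.t_pos.le))
    · exact mul_nonneg_of_nonpos_of_nonpos
        (sub_nonpos.2 (Real.rpow_le_rpow P.q_pos.le h.le P.t_pos.le))
        (sub_nonpos.2 (Real.rpow_le_rpow P.p_pos.le (P.p_lt_q.trans h).le P.t_pos.le))
  have h4 := h1.tendsto
  rw [h2] at h4
  have h5 := tendsto_re_zero_of_sq (mul_nonneg h3 (sq_nonneg _)) h4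
  exact (h5.eventually (gt_mem_nhds hε)).mono fun z hz => le_of_lt hz

theorem tendsto_cpow_neg_cobounded {s : ℝ} (hs : 0 < s) :
    Tendsto (fun z : ℂ => z ^ (-(s : ℂ))) (Bornology.cobounded ℂ) (𝓝 0) := by
  rw [tendsto_zero_iff_norm_tendsto_zero]
  have h1 := (tendsto_rpow_neg_atTop hs).comp (tendsto_norm_cobounded_atTop (E := ℂ))
  refine h1.congr' ?_
  filter_upwards [Bornology.eventually_ne_cobounded (0 : ℂ)] with z hz
  rw [Function.comp, ← Complex.norm_cpow_real, Complex.ofReal_neg]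

theorem jumpTerm_cobounded (k : Fin N) {ε : ℝ} (hε : 0 < ε) :
    ∀ᶠ z in Bornology.cobounded ℂ, (P.jumpTerm k z).re ≤ ε := by
  have he : 0 < P.e k := zero_lt_one.trans_le (P.one_le_e k)
  have h1 := tendsto_cpow_neg_cobounded he
  obtain ⟨c, hc⟩ : ∃ c : ℝ, Tendsto (fun z : ℂ => z ^ ((P.t : ℂ) - P.e k))
      (Bornology.cobounded ℂ) (𝓝 c) := by
    rcases (P.t_le_one.trans (P.one_le_e k)).eq_or_lt with h | h
    · refine ⟨1, ?_⟩
      simp [h]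
    · refine ⟨0, ?_⟩
      have := tendsto_cpow_neg_cobounded (sub_pos.2 h)
      simpa using this
  have h2 : Tendsto (fun z => P.jumpTerm k z ^ 2) (Bornology.cobounded ℂ)
      (𝓝 (-((c ^ 2 : ℝ) : ℂ))) := by
    have h3 := (((h1.const_mul ((P.q ^ P.t : ℝ) : ℂ)).sub hc).mul
      ((h1.const_mul ((P.p ^ P.t : ℝ) : ℂ)).sub hc)).neg
    have h4 : -((((P.q ^ P.t : ℝ) : ℂ) * 0 - c) * (((P.p ^ P.t : ℝ) : ℂ) * 0 - c)) =
        -((c ^ 2 : ℝ) : ℂ) := by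
      push_cast
      ring
    rw [h4] at h3
    refine h3.congr' ?_
    filter_upwards [Bornology.eventually_ne_cobounded (0 : ℂ)] with z hz
    rw [P.jumpTerm_sq, sub_eq_add_neg (P.t : ℂ), Complex.cpow_add _ _ hz]
    ring
  have h5 := tendsto_re_zero_of_sq (sq_nonneg c) h2
  exact (h5.eventually (gt_mem_nhds hε)).mono fun z hz => le_of_lt hz

theorem jumpTerm_of_neg (k : Fin N) {x : ℝ} (hx : x < 0) {ε : ℝ} (hε : 0 < ε) :
    ∀ᶠ z in 𝓝[{z : ℂ | z.im < 0}] (x : ℂ), (P.jumpTerm k z).re ≤ ε := by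
  set s : ℂ := (Real.log ‖(x : ℂ)‖ : ℂ) - Real.pi * I with hs
  have hlog : Tendsto Complex.log (𝓝[{z : ℂ | z.im < 0}] (x : ℂ)) (𝓝 s) :=
    Complex.tendsto_log_nhdsWithin_im_neg_of_re_neg_of_im_zero (by simpa using hx) (by simp)
  have hcpow : ∀ a : ℂ, Tendsto (fun z : ℂ => z ^ a) (𝓝[{z : ℂ | z.im < 0}] (x : ℂ))
      (𝓝 (exp (s * a))) := by
    intro a
    refine ((Complex.continuous_exp.tendsto _).comp (hlog.mul_const a)).congr' ?_
    filter_upwards [self_mem_nhdsWithin] with z hz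
    have h0 : z ≠ 0 := by
      rintro rfl
      simp at hz
    rw [Complex.cpow_def_of_ne_zero h0]
    rfl
  set ρ : ℝ := Real.exp (Real.log ‖(x : ℂ)‖ * P.t) with hρ
  set η : ℝ := Real.pi - P.t * Real.pi with hη
  have hpi := Real.pi_pos
  have hu : -exp (s * P.t) = ρ * exp (η * I) := by
    rw [hρ, hη, Complex.ofReal_exp, ← Complex.exp_add, hs,
      show ((Real.log ‖(x : ℂ)‖ * P.t : ℝ) : ℂ) + ((Real.pi - P.t * Real.pi : ℝ) : ℂ) * I =
        (Real.log ‖(x : ℂ)‖ - Real.pi * I) * P.t + Real.pi * I by push_cast; ring,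
      Complex.exp_add _ (Real.pi * I), Complex.exp_pi_mul_I]
    ring
  have hsec : ∀ c : ℝ, 0 < c → ((c : ℂ) - exp (s * P.t)) ∈ slitPlane ∧
      0 ≤ ((c : ℂ) - exp (s * P.t)).arg ∧ ((c : ℂ) - exp (s * P.t)).arg ≤ η := by
    intro c hc
    rw [sub_eq_add_neg, hu]
    exact Complex.arg_add_ofReal_mem hc (Real.exp_pos _)
      (by rw [hη]; nlinarith [P.t_le_one]) (by rw [hη]; nlinarith [P.t_pos])
  have hsqrt : ∀ c : ℝ, 0 < c → Tendsto (fun z : ℂ => Complex.sqrt (c - z ^ (P.t : ℂ)))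
      (𝓝[{z : ℂ | z.im < 0}] (x : ℂ)) (𝓝 (Complex.sqrt (c - exp (s * P.t)))) := fun c hc =>
    (Complex.differentiableAt_sqrt (hsec c hc).1).continuousAt.tendsto.comp
      ((hcpow P.t).const_sub _)
  have hP : 0 < P.p ^ P.t := Real.rpow_pos_of_pos P.p_pos _
  have hQ : 0 < P.q ^ P.t := Real.rpow_pos_of_pos P.q_pos _
  have hlim := (((hsqrt _ hQ).mul (hsqrt _ hP)).mul (hcpow (-(P.e k : ℂ)))).const_mul (-I)
  have hre := (continuous_re.tendsto _).comp hlim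
  refine (hre.eventually (gt_mem_nhds (lt_of_le_of_lt ?_ hε))).mono fun z hz => le_of_lt hz
  obtain ⟨q1, q2, q3⟩ := hsec _ hQ
  obtain ⟨p1, p2, p3⟩ := hsec _ hP
  set wq : ℂ := ((P.q ^ P.t : ℝ) : ℂ) - exp (s * P.t)
  set wp : ℂ := ((P.p ^ P.t : ℝ) : ℂ) - exp (s * P.t)
  have hI : -I = exp (-(Real.pi / 2) * I) := by
    rw [neg_mul, Complex.exp_neg, Complex.exp_pi_div_two_mul_I, Complex.inv_I]
  rw [_root_.sqrt_eq_exp (slitPlane_ne_zero q1), _root_.sqrt_eq_exp (slitPlane_ne_zero p1), hI,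
    ← Complex.exp_add, ← Complex.exp_add, ← Complex.exp_add, Complex.exp_re]
  have him : (-(Real.pi / 2) * I + (Complex.log wq / 2 + Complex.log wp / 2 +
      s * -(P.e k : ℂ))).im = -(Real.pi / 2) + wq.arg / 2 + wp.arg / 2 + P.e k * Real.pi := by
    simp [hs, Complex.log_im]
    ring
  rw [him]
  refine mul_nonpos_of_nonneg_of_nonpos (Real.exp_pos _).le
    (Real.cos_nonpos_of_pi_div_two_le_of_le ?_ ?_)
  · nlinarith [P.one_le_e k]
  · nlinarith [P.e_le k]

theorem remainder_im_ofReal {x : ℝ} (hx : 0 < x) (hx' : x ∉ Set.Ioo P.p P.q) :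
    (P.remainder x).im = 0 := by
  have h : P.remainder x = ∫ y in Set.Ioo P.p P.q,
      ((√((P.q - y) * (y - P.p)) * ((x - y)⁻¹ * ((P.weight x).re - (P.weight y).re)) : ℝ) : ℂ) := by
    refine MeasureTheory.setIntegral_congr_fun measurableSet_Ioo fun y hy => ?_
    have hxy : x ≠ y := fun h => hx' (h ▸ hy)
    have hre : ∀ {y : ℝ}, 0 < y → P.weight y = ((P.weight y).re : ℂ) := fun hy =>
      Complex.ext rfl (by simpa using P.weight_im_ofReal hy)
    have hd : dslope P.weight y x =
        (((x - y)⁻¹ * ((P.weight x).re - (P.weight y).re) : ℝ) : ℂ) := by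
      rw [dslope_of_ne _ (by exact_mod_cast hxy), slope_def_field, hre hx,
        hre (P.p_pos.trans hy.1)]
      push_cast
      simp only [Complex.ofReal_re]
      rw [div_eq_inv_mul]
    show (√((P.q - y) * (y - P.p)) : ℂ) * dslope P.weight y x = _
    rw [hd]
    push_cast
    rfl
  rw [h, integral_complex_ofReal, Complex.ofReal_im]

theorem glue_im_endpoint {x : ℝ} (hx : x = P.p ∨ x = P.q) : (P.glue x).im = 0 := by
  have hx0 : 0 < x := by
    rcases hx with rfl | rfl
    exacts [P.p_pos, P.q_pos]
  have hx' : x ∉ Set.Ioo P.p P.q := by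
    rcases hx with rfl | rfl <;> simp
  have hs : Complex.sqrt ((x : ℂ) - P.p) * Complex.sqrt (P.q - x) = 0 := by
    rcases hx with rfl | rfl <;> simp [Complex.sqrt]
  have hw : P.weight x = ((P.weight x).re : ℂ) :=
    Complex.ext rfl (by simpa using P.weight_im_ofReal hx0)
  rw [glue, hs, mul_zero, sub_zero, Complex.sub_im, P.remainder_im_ofReal hx0 hx', hw, sub_zero,
    Complex.im_ofReal_mul, Complex.im_ofReal_mul, Complex.sub_im, Complex.ofReal_im]
  simp

theorem glue_continuousAt_endpoint {x : ℝ} (hx : x = P.p ∨ x = P.q) :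
    ContinuousAt P.glue x := by
  have hx0 : 0 < x := by
    rcases hx with rfl | rfl
    exacts [P.p_pos, P.q_pos]
  have hp : ContinuousAt (fun z : ℂ => Complex.sqrt (z - P.p)) x := by
    refine ContinuousAt.comp (Complex.continuousAt_sqrt (Or.inl ?_))
      (f := fun z : ℂ => z - P.p) (by fun_prop)
    rcases hx with rfl | rfl
    · simp
    · simpa using P.p_lt_q.le
  have hq : ContinuousAt (fun z : ℂ => Complex.sqrt (P.q - z)) x := by
    refine ContinuousAt.comp (Complex.continuousAt_sqrt (Or.inl ?_))
      (f := fun z : ℂ => P.q - z) (by fun_prop)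
    rcases hx with rfl | rfl
    · simpa using P.p_lt_q.le
    · simp
  have hr : ContinuousAt P.remainder x := (P.remainder_differentiableOn.differentiableAt
    (isOpen_re_pos.mem_nhds (show (x : ℂ) ∈ {z : ℂ | 0 < z.re} by simpa using hx0))).continuousAt
  unfold glue
  exact ((P.weight_continuousAt hx0).mul (continuousAt_const.mul
    ((continuousAt_id.sub continuousAt_const).sub (continuousAt_const.mul (hp.mul hq))))).sub hr

theorem G_im_tendsto {x : ℝ} (hx : x ∉ Set.Icc P.p P.q) :
    Tendsto (fun z => (P.G z).im) (𝓝 (x : ℂ)) (𝓝 0) := by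
  have h : ContinuousAt P.G x := (P.G_differentiableAt (by simpa using hx)).continuousAt
  have h1 := (continuous_im.tendsto _).comp h.tendsto
  rwa [show (P.G x).im = 0 from cauchyInt_im_ofReal _ _ _ _] at h1

theorem neg_le_Gext_im_nhds {x : ℝ} (hx : x ∉ Set.Ioo P.p P.q) (hx0 : x ≠ 0) {ε : ℝ}
    (hε : 0 < ε) : ∀ᶠ z in 𝓝[P.domain] (x : ℂ), -ε ≤ (P.Gext z).im := by
  by_cases hxe : x = P.p ∨ x = P.q
  · have hx0 : 0 < x := by
      rcases hxe with rfl | rfl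
      exacts [P.p_pos, P.q_pos]
    have h1 := (continuous_im.tendsto _).comp (P.glue_continuousAt_endpoint hxe).tendsto
    rw [P.glue_im_endpoint hxe] at h1
    refine Filter.Eventually.filter_mono nhdsWithin_le_nhds ?_
    filter_upwards [h1.eventually (lt_mem_nhds (neg_lt_zero.2 hε)), isOpen_re_pos.mem_nhds
      (show (x : ℂ) ∈ {z : ℂ | 0 < z.re} by simpa using hx0)] with z hz hz'
    rw [P.Gext_eq_glue hz']
    exact hz.le
  have hxI : x ∉ Set.Icc P.p P.q := by
    push Not at hxe
    exact fun h => hx ⟨lt_of_le_of_ne h.1 hxe.1.symm, lt_of_le_of_ne h.2 hxe.2⟩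
  have hjump : ∀ᶠ z in 𝓝 (x : ℂ), z.im < 0 → (P.jump z).im ≤ ε / 2 := by
    rcases lt_or_gt_of_ne hx0 with h | h
    · exact eventually_nhdsWithin_iff.1
        (P.jump_im_le (fun k ε hε => P.jumpTerm_of_neg k h hε) (half_pos hε))
    · exact (P.jump_im_le (fun k ε hε => P.jumpTerm_of_pos k h hxI hε) (half_pos hε)).mono
        fun z hz _ => hz
  have hre : ∀ᶠ z in 𝓝 (x : ℂ), z.re ∉ Set.Icc P.p P.q :=
    (continuous_re.tendsto (x : ℂ)).eventually (isClosed_Icc.isOpen_compl.mem_nhds hxI)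
  rw [eventually_nhdsWithin_iff]
  filter_upwards [hjump, hre, (P.G_im_tendsto hxI).eventually
    (lt_mem_nhds (neg_lt_zero.2 (half_pos hε)))] with z hj hre hG hz
  rw [Gext]
  split_ifs with h1 h2
  · linarith
  · rw [Complex.sub_im]
    linarith [hj h2]
  · exact absurd (Set.Ioo_subset_Icc_self (hz (le_antisymm (not_lt.1 h1) (not_lt.1 h2)))) hre

theorem neg_le_Gext_im_cobounded {ε : ℝ} (hε : 0 < ε) :
    ∀ᶠ z in Bornology.cobounded ℂ ⊓ 𝓟 P.domain, -ε ≤ (P.Gext z).im := by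
  rw [Filter.eventually_inf_principal]
  have hG := (continuous_im.tendsto _).comp
    (cauchyInt_tendsto_cobounded P.p_pos P.p_lt_q P.density_integrableOn)
  rw [Complex.zero_im] at hG
  have hb : ∀ᶠ z : ℂ in Bornology.cobounded ℂ, P.q < ‖z‖ :=
    (tendsto_norm_cobounded_atTop (E := ℂ)).eventually (eventually_gt_atTop _)
  filter_upwards [hb, hG.eventually (lt_mem_nhds (neg_lt_zero.2 (half_pos hε))),
    P.jump_im_le (fun k ε hε => P.jumpTerm_cobounded k hε) (half_pos hε)] with z hb hG hj hz
  have hG' : -(ε / 2) < (P.G z).im := hG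
  rw [Gext]
  split_ifs with h1 h2
  · linarith
  · rw [Complex.sub_im]
    linarith
  · have him : z.im = 0 := le_antisymm (not_lt.1 h1) (not_lt.1 h2)
    have hm := hz him
    rw [show z = (z.re : ℂ) from Complex.ext rfl (by simpa using him), Complex.norm_real,
      Real.norm_eq_abs, abs_of_pos (P.p_pos.trans hm.1)] at hb
    exact absurd hm.2 hb.not_gt

/-- At the boundary of the domain, away from the origin approached from below, the imaginary
part of the continuation is asymptotically nonnegative. -/
theorem ultrafilter_domain (U : Ultrafilter ℂ) (hU : P.domain ∈ U) :
    (∃ z ∈ P.domain, (U : Filter ℂ) ≤ 𝓝 z) ∨ (U : Filter ℂ) ≤ 𝓝[{z | z.im < 0}] 0 ∨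
      ∀ ε > 0, ∀ᶠ z in U, -ε ≤ (P.Gext z).im := by
  have hUd : (U : Filter ℂ) ≤ 𝓟 P.domain := le_principal_iff.2 hU
  by_cases hb : ∃ R, Metric.closedBall (0 : ℂ) R ∈ U
  · obtain ⟨R, hR⟩ := hb
    obtain ⟨z, -, hz⟩ := (isCompact_closedBall (0 : ℂ) R).ultrafilter_le_nhds U
      (le_principal_iff.2 hR)
    by_cases hzd : z ∈ P.domain
    · exact Or.inl ⟨z, hzd, hz⟩
    right
    obtain ⟨him, hre⟩ : z.im = 0 ∧ z.re ∉ Set.Ioo P.p P.q := by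
      simpa [domain] using hzd
    obtain ⟨x, rfl⟩ : ∃ x : ℝ, z = x := ⟨z.re, Complex.ext rfl (by simpa using him)⟩
    rw [Complex.ofReal_re] at hre
    by_cases hx0 : x = 0
    · subst hx0
      rw [Complex.ofReal_zero] at hz
      rcases U.mem_or_compl_mem {z : ℂ | z.im < 0} with h | h
      · exact Or.inl (le_inf hz (le_principal_iff.2 h))
      right
      intro ε hε
      have hI : (0 : ℝ) ∉ Set.Icc P.p P.q := fun h => absurd h.1 P.p_pos.not_ge
      have hG := P.G_im_tendsto hI
      rw [Complex.ofReal_zero] at hG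
      have hr : ∀ᶠ z in 𝓝 (0 : ℂ), z.re ∉ Set.Icc P.p P.q :=
        (continuous_re.tendsto (0 : ℂ)).eventually (isClosed_Icc.isOpen_compl.mem_nhds hI)
      filter_upwards [hU, h, hz (hG.eventually (lt_mem_nhds (neg_lt_zero.2 hε))), hz hr]
        with z hzd him hG hr
      have h1 : 0 < z.im := lt_of_le_of_ne (not_lt.1 him) fun h =>
        hr (Set.Ioo_subset_Icc_self (hzd h.symm))
      have hG' : -ε < (P.G z).im := hG
      rw [Gext, if_pos h1]
      exact hG'.le
    · exact Or.inr fun ε hε => (le_inf hz hUd) (P.neg_le_Gext_im_nhds hre hx0 hε)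
  · push Not at hb
    have hc : (U : Filter ℂ) ≤ Bornology.cobounded ℂ := by
      refine ((Metric.hasBasis_cobounded_compl_closedBall (0 : ℂ)).ge_iff).2 fun R _ => ?_
      exact (U.mem_or_compl_mem _).resolve_left (hb R)
    exact Or.inr (Or.inr fun ε hε => (le_inf hc hUd) (P.neg_le_Gext_im_cobounded hε))

end PowerData

theorem tendsto_exp_mul_comap_re_atBot {a : ℝ} (ha : 0 < a) :
    Tendsto (fun s : ℂ => exp (a * s)) (comap re atBot) (𝓝 0) := by
  refine tendsto_exp_comap_re_atBot.comp (tendsto_comap_iff.2 ?_)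
  have : re ∘ (fun s : ℂ => (a : ℂ) * s) = fun s => a * s.re := by
    funext s
    simp
  rw [this]
  exact tendsto_comap.const_mul_atBot ha

/-- An exponential sum with a dominant exponent. -/
theorem tendsto_expSum_mul_exp {N : ℕ} (γ e : Fin N → ℝ) (k₀ : Fin N)
    (he : ∀ k, k ≠ k₀ → e k < e k₀) :
    Tendsto (fun s : ℂ => (∑ k, (γ k : ℂ) * exp (-(e k) * s)) * exp (e k₀ * s))
      (comap re atBot) (𝓝 (γ k₀)) := by
  have h : ∀ k, Tendsto (fun s : ℂ => (γ k : ℂ) * exp (-(e k) * s) * exp (e k₀ * s))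
      (comap re atBot) (𝓝 (if k = k₀ then (γ k₀ : ℂ) else 0)) := by
    intro k
    have h1 : ∀ s : ℂ, (γ k : ℂ) * exp (-(e k) * s) * exp (e k₀ * s) =
        γ k * exp ((e k₀ - e k : ℝ) * s) := by
      intro s
      rw [mul_assoc, ← Complex.exp_add]
      push_cast
      ring_nf
    simp only [h1]
    split_ifs with hk
    · subst hk
      simpa using tendsto_const_nhds
    · simpa using (tendsto_exp_mul_comap_re_atBot (sub_pos.2 (he k hk))).const_mul (γ k : ℂ)
  have h2 := tendsto_finsetSum Finset.univ fun k _ => h k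
  simpa [Finset.sum_mul] using h2

theorem abs_cos_lt_sin_of_mem {θ : ℝ} (h1 : Real.pi / 4 < θ) (h2 : θ < 3 * Real.pi / 4) :
    |Real.cos θ| < Real.sin θ := by
  have hs : 0 < √2 / 2 := by positivity
  have a1 := Real.sin_pos_of_pos_of_lt_pi (x := θ - Real.pi / 4) (by linarith)
    (by linarith [Real.pi_pos])
  have a2 := Real.sin_pos_of_pos_of_lt_pi (x := θ + Real.pi / 4) (by linarith [Real.pi_pos])
    (by linarith)
  rw [Real.sin_sub, Real.cos_pi_div_four, Real.sin_pi_div_four, ← sub_mul] at a1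
  rw [Real.sin_add, Real.cos_pi_div_four, Real.sin_pi_div_four, ← add_mul] at a2
  rw [abs_lt]
  constructor
  · linarith [pos_of_mul_pos_left a2 hs.le]
  · linarith [pos_of_mul_pos_left a1 hs.le]

theorem mem_of_abs_cos_lt_sin {θ : ℝ} (h0 : 0 ≤ θ) (h3 : θ ≤ 2 * Real.pi)
    (h : |Real.cos θ| < Real.sin θ) : Real.pi / 4 < θ ∧ θ < 3 * Real.pi / 4 := by
  have hs : 0 < √2 / 2 := by positivity
  have hpi := Real.pi_pos
  have hlt : θ < Real.pi := by
    by_contra! hge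
    have := Real.sin_nonneg_of_nonneg_of_le_pi (x := θ - Real.pi) (by linarith) (by linarith)
    rw [Real.sin_sub_pi] at this
    linarith [abs_nonneg (Real.cos θ)]
  rw [abs_lt] at h
  constructor
  · by_contra! hle
    have := Real.sin_nonneg_of_nonneg_of_le_pi (x := Real.pi / 4 - θ) (by linarith) (by linarith)
    rw [Real.sin_sub, Real.cos_pi_div_four, Real.sin_pi_div_four] at this
    nlinarith
  · by_contra! hle
    have := Real.sin_nonneg_of_nonneg_of_le_pi (x := θ + Real.pi / 4 - Real.pi) (by linarith)
      (by linarith)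
    rw [Real.sin_sub_pi, Real.sin_add, Real.cos_pi_div_four, Real.sin_pi_div_four] at this
    nlinarith

namespace PowerData

variable {N : ℕ} (P : PowerData N)

/-- The square root factor of the jump as a function of `zᵗ`. -/
noncomputable def jumpFactor (u : ℂ) : ℂ :=
  2 * Real.pi * Complex.sqrt ((P.q ^ P.t : ℝ) - u) * Complex.sqrt ((P.p ^ P.t : ℝ) - u)

/-- The continuation in the lower half-plane, in logarithmic coordinates. -/
noncomputable def logGext (s : ℂ) : ℂ :=
  P.G (exp s) - P.jumpFactor (exp (P.t * s)) * ∑ k, (P.β k : ℂ) * exp (-(P.e k) * s)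

/-- The derivative of `logGext`. -/
noncomputable def logGextDeriv (s : ℂ) : ℂ :=
  deriv P.G (exp s) * exp s - (deriv P.jumpFactor (exp (P.t * s)) * (P.t * exp (P.t * s)) *
    (∑ k, (P.β k : ℂ) * exp (-(P.e k) * s)) -
      P.jumpFactor (exp (P.t * s)) * ∑ k, ((P.β k * P.e k : ℝ) : ℂ) * exp (-(P.e k) * s))

theorem Gext_eq_logGext {z : ℂ} (hz : z.im < 0) : P.Gext z = P.logGext (Complex.log z) := by
  have h0 : z ≠ 0 := by
    rintro rfl
    simp at hz
  rw [Gext, if_neg hz.not_gt, if_pos hz, logGext, Complex.exp_log h0, jump, jumpFactor, powSum,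
    Complex.cpow_def_of_ne_zero h0, mul_comm (Complex.log z)]
  simp only [Complex.cpow_def_of_ne_zero h0, mul_comm (Complex.log z)]

theorem analyticAt_G : AnalyticAt ℂ P.G 0 := by
  have hO : IsOpen (Complex.ofReal '' Set.Icc P.p P.q)ᶜ :=
    (isClosed_ofReal_Icc P.p P.q).isOpen_compl
  refine (cauchyInt_differentiableOn P.density_integrableOn).analyticAt (hO.mem_nhds ?_)
  rintro ⟨y, hy, hy0⟩
  rw [Complex.ofReal_eq_zero] at hy0
  exact absurd hy.1 (by rw [hy0]; exact P.p_pos.not_ge)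

theorem analyticAt_jumpFactor : AnalyticAt ℂ P.jumpFactor 0 := by
  have hs : ∀ c : ℝ, 0 < c → ∀ᶠ u in 𝓝 (0 : ℂ),
      DifferentiableAt ℂ (fun u : ℂ => Complex.sqrt (c - u)) u := by
    intro c hc
    have : ∀ᶠ u in 𝓝 (0 : ℂ), (c - u : ℂ) ∈ slitPlane := by
      refine (show ContinuousAt (fun u : ℂ => (c : ℂ) - u) 0 by fun_prop).eventually_mem
        (Complex.isOpen_slitPlane.mem_nhds (Or.inl ?_))
      simpa using hc
    filter_upwards [this] with u hu
    exact (Complex.differentiableAt_sqrt hu).comp u (by fun_prop)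
  rw [Complex.analyticAt_iff_eventually_differentiableAt]
  filter_upwards [hs _ (Real.rpow_pos_of_pos P.p_pos P.t), hs _ (Real.rpow_pos_of_pos P.q_pos P.t)]
    with u h1 h2
  exact (h2.const_mul _).mul h1

theorem jumpFactor_zero : P.jumpFactor 0 =
    (2 * Real.pi * √(P.q ^ P.t) * √(P.p ^ P.t) : ℝ) := by
  rw [jumpFactor, sub_zero, sub_zero,
    Complex.sqrt_ofReal_of_nonneg (Real.rpow_nonneg P.q_pos.le _),
    Complex.sqrt_ofReal_of_nonneg (Real.rpow_nonneg P.p_pos.le _)]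
  push_cast
  rfl

theorem hasDerivAt_logGext : ∀ᶠ s in comap re atBot, HasDerivAt P.logGext (P.logGextDeriv s) s := by
  have hG := tendsto_exp_comap_re_atBot.eventually P.analyticAt_G.eventually_analyticAt
  have hJ := (tendsto_exp_mul_comap_re_atBot P.t_pos).eventually
    P.analyticAt_jumpFactor.eventually_analyticAt
  filter_upwards [hG, hJ] with s hG hJ
  have hlin : ∀ a : ℂ, HasDerivAt (fun s : ℂ => exp (a * s)) (a * exp (a * s)) s := by
    intro a
    have := ((hasDerivAt_id s).const_mul a).cexp
    simpa [mul_comm] using this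
  have h1 := hG.differentiableAt.hasDerivAt.comp s (Complex.hasDerivAt_exp s)
  have h2 := HasDerivAt.comp (h := fun s : ℂ => exp (P.t * s)) s hJ.differentiableAt.hasDerivAt
    (hlin P.t)
  have h3 : HasDerivAt (fun s : ℂ => ∑ k, (P.β k : ℂ) * exp (-(P.e k) * s))
      (∑ k, (P.β k : ℂ) * (-(P.e k) * exp (-(P.e k) * s))) s :=
    HasDerivAt.fun_sum fun k _ => (hlin _).const_mul _
  refine (h1.sub (h2.mul h3)).congr_deriv ?_
  have h4 : ∑ k, (P.β k : ℂ) * (-(P.e k) * exp (-(P.e k) * s)) =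
      -∑ k, ((P.β k * P.e k : ℝ) : ℂ) * exp (-(P.e k) * s) := by
    rw [← Finset.sum_neg_distrib]
    refine Finset.sum_congr rfl fun k _ => ?_
    push_cast
    ring
  rw [h4, logGextDeriv, Function.comp]
  ring

variable {k₀ : Fin N}

theorem logGext_mul_exp_tendsto (he : ∀ k, k ≠ k₀ → P.e k < P.e k₀) :
    Tendsto (fun s => P.logGext s * exp (P.e k₀ * s)) (comap re atBot)
      (𝓝 (-(P.jumpFactor 0 * P.β k₀))) := by
  have he0 : 0 < P.e k₀ := zero_lt_one.trans_le (P.one_le_e _)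
  have h1 := (P.analyticAt_G.continuousAt.tendsto.comp tendsto_exp_comap_re_atBot).mul
    (tendsto_exp_mul_comap_re_atBot he0)
  have h2 := (P.analyticAt_jumpFactor.continuousAt.tendsto.comp
    (tendsto_exp_mul_comap_re_atBot P.t_pos)).mul (tendsto_expSum_mul_exp P.β P.e k₀ he)
  refine ((h1.sub h2).congr fun s => ?_).trans_eq ?_
  · simp only [Function.comp, logGext]
    ring
  · ring_nf

theorem logGextDeriv_mul_exp_tendsto (he : ∀ k, k ≠ k₀ → P.e k < P.e k₀) :
    Tendsto (fun s => P.logGextDeriv s * exp (P.e k₀ * s)) (comap re atBot)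
      (𝓝 (P.jumpFactor 0 * (P.β k₀ * P.e k₀ : ℝ))) := by
  have he0 : 0 < P.e k₀ := zero_lt_one.trans_le (P.one_le_e _)
  have h1 := ((P.analyticAt_G.deriv.continuousAt.tendsto.comp tendsto_exp_comap_re_atBot).mul
    tendsto_exp_comap_re_atBot).mul (tendsto_exp_mul_comap_re_atBot he0)
  have hJ := P.analyticAt_jumpFactor.continuousAt.tendsto.comp
    (tendsto_exp_mul_comap_re_atBot P.t_pos)
  have hJ' := (P.analyticAt_jumpFactor.deriv.continuousAt.tendsto.comp
    (tendsto_exp_mul_comap_re_atBot P.t_pos)).mul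
    ((tendsto_exp_mul_comap_re_atBot P.t_pos).const_mul (P.t : ℂ))
  have h2 := hJ'.mul (tendsto_expSum_mul_exp P.β P.e k₀ he)
  have h3 := hJ.mul (tendsto_expSum_mul_exp (fun k => P.β k * P.e k) P.e k₀ he)
  refine ((h1.sub (h2.sub h3)).congr fun s => ?_).trans_eq ?_
  · simp only [Function.comp, logGextDeriv]
    ring
  · ring_nf

end PowerData

theorem Complex.re_exp_ofReal_mul (a : ℝ) (s : ℂ) :
    (exp (a * s)).re = Real.exp (a * s.re) * Real.cos (a * s.im) := by
  rw [Complex.exp_re, Complex.re_ofReal_mul, Complex.im_ofReal_mul]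

theorem Complex.im_exp_ofReal_mul (a : ℝ) (s : ℂ) :
    (exp (a * s)).im = Real.exp (a * s.re) * Real.sin (a * s.im) := by
  rw [Complex.exp_im, Complex.re_ofReal_mul, Complex.im_ofReal_mul]

namespace PowerData

variable {N : ℕ} (P : PowerData N) {k₀ : Fin N}

theorem eventually_lt_of_tendsto_pos {α : Type*} {F : Filter α} {g : α → ℂ} {c : ℝ} (hc : 0 < c)
    (h : Tendsto g F (𝓝 (c : ℂ))) : ∀ᶠ x in F, |(g x).im| < (g x).re := by
  have h1 := (continuous_im.tendsto _).comp h
  have h2 := (continuous_re.tendsto _).comp h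
  rw [Complex.ofReal_im] at h1
  have h3 := h1.abs
  rw [abs_zero] at h3
  exact h3.eventually_lt h2 (by simpa using hc)

theorem exists_jumpFactor_zero : ∃ j : ℝ, 0 < j ∧ P.jumpFactor 0 = j := by
  refine ⟨_, ?_, P.jumpFactor_zero⟩
  have := Real.rpow_pos_of_pos P.p_pos P.t
  have := Real.rpow_pos_of_pos P.q_pos P.t
  have := Real.pi_pos
  positivity

/-- Near the origin in the lower half-plane, the continuation takes each value on the negative
imaginary axis at most once. -/
theorem exists_unique_near_zero (he : ∀ k, k ≠ k₀ → P.e k < P.e k₀) :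
    ∃ R : ℝ, ∀ M : ℝ, 0 < M → ∀ z z' : ℂ, z.im < 0 → z'.im < 0 → (Complex.log z).re < R →
      (Complex.log z').re < R → P.Gext z = -(M * I) → P.Gext z' = -(M * I) → z = z' := by
  obtain ⟨j, hj, hj0⟩ := P.exists_jumpFactor_zero
  have he1 := P.one_le_e k₀
  have he2 : P.e k₀ ≤ 2 := (P.e_le k₀).trans (by linarith [P.t_le_one])
  have hpi := Real.pi_pos
  set ε := P.e k₀ with hε
  have he0 : 0 < ε := by linarith
  have ht1 := (P.logGext_mul_exp_tendsto he).neg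
  have ht2 := P.logGextDeriv_mul_exp_tendsto he
  rw [hj0, neg_neg, ← Complex.ofReal_mul] at ht1
  rw [hj0, ← Complex.ofReal_mul] at ht2
  have hβ := P.β_pos k₀
  obtain ⟨R, -, hR⟩ := ((atBot_basis_Iio (α := ℝ)).comap re).eventually_iff.1
    (P.hasDerivAt_logGext.and ((eventually_lt_of_tendsto_pos (mul_pos hj hβ) ht1).and
      (eventually_lt_of_tendsto_pos (mul_pos hj (mul_pos hβ he0)) ht2)))
  refine ⟨R, fun M hM z z' hz hz' hzR hzR' hGz hGz' => ?_⟩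
  set V : Set ℂ := {s | s.re < R} ∩ ({s | -(3 * Real.pi / 4) / ε < s.im} ∩
    {s | s.im < -(Real.pi / 4) / ε}) with hV
  have hVc : Convex ℝ V := (convex_halfSpace_re_lt R).inter
    ((convex_halfSpace_im_gt _).inter (convex_halfSpace_im_lt _))
  have hcos : ∀ s ∈ V, |Real.cos (-(ε * s.im))| < Real.sin (-(ε * s.im)) := by
    rintro s ⟨-, h1, h2⟩
    rw [Set.mem_ofPred_eq, div_lt_iff₀ he0] at h1
    rw [Set.mem_ofPred_eq, lt_div_iff₀ he0] at h2
    exact abs_cos_lt_sin_of_mem (by linarith) (by linarith)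
  have hmem : ∀ z : ℂ, z.im < 0 → (Complex.log z).re < R → P.Gext z = -(M * I) →
      Complex.log z ∈ V := by
    intro z hz hzR hGz
    have harg : z.arg < 0 := Complex.arg_neg_iff.2 hz
    have harg' := Complex.neg_pi_lt_arg z
    have h1 := (hR hzR).2.1
    rw [← P.Gext_eq_logGext hz, hGz, Complex.neg_re, Complex.neg_im, abs_neg] at h1
    have hre : (-(M * I) * exp (ε * Complex.log z)).re =
        -(M * Real.exp (ε * (Complex.log z).re) * Real.sin (-(ε * z.arg))) := by
      simp only [Complex.mul_re, Complex.mul_im, Complex.neg_re, Complex.neg_im, Complex.I_re,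
        Complex.I_im, Complex.ofReal_re, Complex.ofReal_im, im_exp_ofReal_mul, Complex.log_im,
        Real.sin_neg]
      ring
    have him : (-(M * I) * exp (ε * Complex.log z)).im =
        -(M * Real.exp (ε * (Complex.log z).re) * Real.cos (-(ε * z.arg))) := by
      simp only [Complex.mul_re, Complex.mul_im, Complex.neg_re, Complex.neg_im, Complex.I_re,
        Complex.I_im, Complex.ofReal_re, Complex.ofReal_im, re_exp_ofReal_mul, Complex.log_im,
        Real.cos_neg]
      ring
    rw [him, hre, neg_neg, abs_neg, abs_mul, abs_of_pos (mul_pos hM (Real.exp_pos _))] at h1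
    have h4 := lt_of_mul_lt_mul_left h1 (mul_pos hM (Real.exp_pos _)).le
    obtain ⟨h5, h6⟩ := mem_of_abs_cos_lt_sin (by nlinarith) (by nlinarith) h4
    refine ⟨hzR, ?_, ?_⟩
    · rw [Set.mem_ofPred_eq, div_lt_iff₀ he0, Complex.log_im]
      linarith
    · rw [Set.mem_ofPred_eq, lt_div_iff₀ he0, Complex.log_im]
      linarith
  have hderiv : ∀ s ∈ V, 0 < (-I * P.logGextDeriv s).re := by
    intro s hs
    have h1 := (hR hs.1).2.2
    have h2 := hcos s hs
    have h3 : P.logGextDeriv s = P.logGextDeriv s * exp (ε * s) * exp ((-ε : ℝ) * s) := by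
      rw [mul_assoc, ← Complex.exp_add, Complex.ofReal_neg, neg_mul, add_neg_cancel,
        Complex.exp_zero, mul_one]
    set v := P.logGextDeriv s * exp (ε * s)
    rw [h3]
    have h5 : (-I * (v * exp ((-ε : ℝ) * s))).re = Real.exp (-ε * s.re) *
        (v.re * Real.sin (-(ε * s.im)) + v.im * Real.cos (-(ε * s.im))) := by
      simp only [Complex.mul_re, Complex.mul_im, Complex.neg_re, Complex.I_re,
        Complex.I_im, re_exp_ofReal_mul, im_exp_ofReal_mul, neg_mul]
      ring
    rw [h5]
    refine mul_pos (Real.exp_pos _) ?_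
    have h6 : |v.im * Real.cos (-(ε * s.im))| < v.re * Real.sin (-(ε * s.im)) := by
      rw [abs_mul]
      exact mul_lt_mul'' h1 h2 (abs_nonneg _) (abs_nonneg _)
    linarith [(abs_lt.1 h6).1]
  have hlog : Complex.log z = Complex.log z' := by
    by_contra hne
    have := re_mul_slope_pos hVc (fun s hs => (hR hs.1).1) hderiv (hmem z hz hzR hGz)
      (hmem z' hz' hzR' hGz') hne
    rw [← P.Gext_eq_logGext hz, ← P.Gext_eq_logGext hz', hGz, hGz'] at this
    simp at this
  have h0 : ∀ z : ℂ, z.im < 0 → z ≠ 0 := by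
    rintro z hz rfl
    simp at hz
  rw [← Complex.exp_log (h0 z hz), hlog, Complex.exp_log (h0 z' hz')]

theorem tendsto_log_nhds_zero :
    Tendsto Complex.log (𝓝[{z : ℂ | z.im < 0}] 0) (comap re atBot) := by
  rw [tendsto_comap_iff]
  have h : re ∘ Complex.log = fun z => Real.log ‖z‖ := by
    funext z
    simp [Complex.log_re]
  rw [h]
  refine (Real.tendsto_log_nhdsGT_zero.comp tendsto_norm_nhdsNE_zero).mono_left ?_
  refine nhdsWithin_mono _ ?_
  rintro z hz rfl
  simp at hz

theorem not_tendsto_Gext_of_le_nhds_zero (he : ∀ k, k ≠ k₀ → P.e k < P.e k₀) {U : Filter ℂ}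
    [U.NeBot] (hU : U ≤ 𝓝[{z | z.im < 0}] 0) (w : ℂ) : ¬Tendsto P.Gext U (𝓝 w) := by
  intro h
  obtain ⟨j, hj, hj0⟩ := P.exists_jumpFactor_zero
  have he0 : 0 < P.e k₀ := zero_lt_one.trans_le (P.one_le_e _)
  have hlog := tendsto_log_nhds_zero.mono_left hU
  have h1 := h.mul ((tendsto_exp_mul_comap_re_atBot he0).comp hlog)
  have h2 := (P.logGext_mul_exp_tendsto he).comp hlog
  have h3 : -(P.jumpFactor 0 * P.β k₀) = w * 0 := by
    refine tendsto_nhds_unique h2 (h1.congr' ?_)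
    filter_upwards [hU self_mem_nhdsWithin] with z hz
    rw [P.Gext_eq_logGext hz]
    rfl
  rw [hj0, mul_zero, neg_eq_zero] at h3
  exact (mul_pos hj (P.β_pos k₀)).ne' (by exact_mod_cast h3)

theorem Gext_proper (he : ∀ k, k ≠ k₀ → P.e k < P.e k₀) (U : Ultrafilter ℂ) (hU : P.domain ∈ U)
    (w : ℂ) (hw : w.im < 0) (h : Tendsto P.Gext U (𝓝 w)) :
    ∃ z ∈ P.domain, (U : Filter ℂ) ≤ 𝓝 z := by
  rcases P.ultrafilter_domain U hU with h1 | h1 | h1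
  · exact h1
  · exact absurd h (P.not_tendsto_Gext_of_le_nhds_zero he h1 w)
  · have h2 := ge_of_tendsto ((continuous_im.tendsto _).comp h) (h1 (-w.im / 2) (by linarith))
    linarith

theorem Gext_unique (he : ∀ k, k ≠ k₀ → P.e k < P.e k₀) :
    ∃ M₀ : ℝ, ∀ M, M₀ ≤ M → ∀ z ∈ P.domain, ∀ z' ∈ P.domain,
      P.Gext z = -(M * I) → P.Gext z' = -(M * I) → z = z' := by
  obtain ⟨R, hR⟩ := P.exists_unique_near_zero he
  suffices h : ∃ M₀ : ℕ, ∀ M : ℝ, M₀ ≤ M → ∀ z ∈ P.domain, P.Gext z = -(M * I) →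
      z.im < 0 ∧ (Complex.log z).re < R by
    obtain ⟨M₀, hM₀⟩ := h
    refine ⟨max M₀ 1, fun M hM z hz z' hz' hGz hGz' => ?_⟩
    have h1 := hM₀ M ((le_max_left _ _).trans hM) z hz hGz
    have h2 := hM₀ M ((le_max_left _ _).trans hM) z' hz' hGz'
    exact hR M (zero_lt_one.trans_le ((le_max_right _ _).trans hM)) z z' h1.1 h2.1 h1.2 h2.2
      hGz hGz'
  by_contra! h
  choose M hM z hzd hGz hz using h
  set U : Ultrafilter ℂ := (hyperfilter ℕ).map z with hU
  have hUd : P.domain ∈ U := Ultrafilter.mem_map.2 (univ_mem' hzd)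
  have hMtop : Tendsto M (hyperfilter ℕ) atTop :=
    (tendsto_atTop_mono hM tendsto_natCast_atTop_atTop).mono_left Nat.hyperfilter_le_atTop
  rcases P.ultrafilter_domain U hUd with ⟨z₀, hz₀, h1⟩ | h1 | h1
  · have h2 : Tendsto (fun n => ‖P.Gext (z n)‖) (hyperfilter ℕ) (𝓝 ‖P.Gext z₀‖) :=
      ((P.Gext_analyticOnNhd z₀ hz₀).continuousAt.tendsto.norm).comp h1
    have h3 : (fun n => ‖P.Gext (z n)‖) = fun n => |M n| := by
      funext n
      simp [hGz]
    rw [h3] at h2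
    exact not_tendsto_nhds_of_tendsto_atTop (tendsto_abs_atTop_atTop.comp hMtop) _ h2
  · have h2 : Tendsto z (hyperfilter ℕ) (𝓝[{z | z.im < 0}] 0) := h1
    have h3 : ∀ᶠ n in hyperfilter ℕ, (z n).im < 0 := h2.eventually self_mem_nhdsWithin
    have h4 := (tendsto_comap.comp (tendsto_log_nhds_zero.comp h2)).eventually
      (eventually_lt_atBot R)
    obtain ⟨n, hn, hn'⟩ := (h3.and h4).exists
    exact absurd hn' (hz n hn).not_gt
  · have h2 : ∀ᶠ n in hyperfilter ℕ, -1 ≤ (P.Gext (z n)).im := h1 1 one_pos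
    obtain ⟨n, hn, hn'⟩ := (h2.and (hMtop.eventually (eventually_gt_atTop 1))).exists
    rw [hGz] at hn
    simp at hn
    linarith

theorem Gext_eq_G {z : ℂ} (hz : 0 < z.im) : P.Gext z = P.G z := if_pos hz

/-- The right inverse of the Cauchy transform continues to the lower half-plane. -/
theorem exists_univalent_inverse (hN : 0 < N) (he : ∀ k, k ≠ k₀ → P.e k < P.e k₀) :
    ∃ F : ℂ → ℂ, AnalyticOnNhd ℂ F {z | z.im < 0} ∧ Set.InjOn F {z | z.im < 0} ∧
      ∃ δ : ℝ, 0 < δ ∧ ∀ w : ℂ, ‖w‖ < δ → w.im < 0 → 0 < (F w).im ∧ P.G (F w) = w := by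
  have hpos : ∀ y ∈ Set.Ioo P.p P.q, 0 < P.density y := fun y hy => P.density_pos hN hy
  obtain ⟨δ, hδ, hG⟩ := exists_cauchyInt_eq P.p_pos P.p_lt_q P.density_integrableOn hpos
  have hd : ∀ z : ℂ, 0 < z.im → z ∈ P.domain := fun z hz h => absurd h hz.ne'
  have hval : ∀ z : ℂ, 0 < z.im → (P.Gext z).im < 0 := fun z hz => by
    rw [P.Gext_eq_G hz]
    exact cauchyInt_im_neg P.p_lt_q P.density_integrableOn hpos hz
  have hnc : ¬∃ c, ∀ z ∈ P.domain, P.Gext z = c := by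
    rintro ⟨c, hc⟩
    have h1 : ∀ s : ℝ, 0 < s → s < δ → -(s * I) = c := by
      intro s hs hsδ
      obtain ⟨z, hz, hGz⟩ := hG (-(s * I)) (by simpa [abs_of_pos hs] using hsδ) (by simpa using hs)
      rw [← hGz, ← hc z (hd z hz), P.Gext_eq_G hz]
      rfl
    have h2 := congrArg Complex.im ((h1 (δ / 2) (by linarith) (by linarith)).trans
      (h1 (δ / 3) (by linarith) (by linarith)).symm)
    simp at h2
    linarith
  obtain ⟨F, hF, hinj, hFG⟩ := exists_inverse_of_proper P.isOpen_domain P.isConnected_domain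
    P.Gext_analyticOnNhd hnc ⟨I, hd I (by simp), hval I (by simp)⟩ (P.Gext_proper he)
    (P.Gext_unique he)
  refine ⟨F, hF, hinj, δ, hδ, fun w hw hw' => ?_⟩
  obtain ⟨z, hz, hGz⟩ := hG w hw hw'
  have h1 : F w = z := by
    have := hFG z (hd z hz) (hval z hz)
    rwa [P.Gext_eq_G hz, show P.G z = w from hGz] at this
  rw [h1]
  exact ⟨hz, hGz⟩

end PowerData

theorem gpfpDensity_nonneg {a b : ℝ} (ha : 0 < a) {N : ℕ} {α l : Fin N → ℝ} (hα : ∀ k, 0 < α k)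
    {x : ℝ} (hx : x ∈ Set.Ioo a b) : 0 ≤ gpfpDensity a b N α l x := by
  have hx0 : 0 < x := ha.trans hx.1
  exact mul_nonneg (div_nonneg (Real.sqrt_nonneg _) hx0.le)
    (Finset.sum_nonneg fun k _ => mul_nonneg (hα k).le (Real.rpow_nonneg hx0.le _))

theorem measurable_gpfpDensity (a b : ℝ) (N : ℕ) (α l : Fin N → ℝ) :
    Measurable (gpfpDensity a b N α l) := by
  unfold gpfpDensity
  fun_prop

theorem integral_GPFP {a b : ℝ} (ha : 0 < a) {N : ℕ} {α l : Fin N → ℝ} (hα : ∀ k, 0 < α k)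
    (g : ℝ → ℂ) : ∫ x, g x ∂(GPFP a b N α l) =
      ∫ x in Set.Ioo a b, gpfpDensity a b N α l x • g x := by
  have hm : Measurable ((Set.Ioo a b).indicator (gpfpDensity a b N α l)) :=
    (measurable_gpfpDensity a b N α l).indicator measurableSet_Ioo
  rw [GPFP, integral_withDensity_eq_integral_toReal_smul hm.ennreal_ofReal
    (Eventually.of_forall fun _ => ENNReal.ofReal_lt_top), ← integral_indicator measurableSet_Ioo]
  congr 1
  funext x
  by_cases hx : x ∈ Set.Ioo a b
  · rw [Set.indicator_of_mem hx, Set.indicator_of_mem hx,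
      ENNReal.toReal_ofReal (gpfpDensity_nonneg ha hα hx)]
  · rw [Set.indicator_of_notMem hx, Set.indicator_of_notMem hx, ENNReal.ofReal_zero,
      ENNReal.toReal_zero, zero_smul]

theorem rpow_image_Ioo {a b r : ℝ} (ha : 0 < a) (hb : 0 < b) (hr : r < 0) :
    (fun x : ℝ => x ^ r) '' Set.Ioo a b = Set.Ioo (b ^ r) (a ^ r) := by
  ext y
  constructor
  · rintro ⟨x, hx, rfl⟩
    exact ⟨Real.rpow_lt_rpow_of_neg (ha.trans hx.1) hx.2 hr, Real.rpow_lt_rpow_of_neg ha hx.1 hr⟩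
  · rintro ⟨h1, h2⟩
    have hy : 0 < y := (Real.rpow_pos_of_pos hb r).trans h1
    have hinv : ∀ {c : ℝ}, 0 < c → (c ^ r) ^ r⁻¹ = c := fun hc => Real.rpow_rpow_inv hc.le hr.ne
    refine ⟨y ^ r⁻¹, ⟨?_, ?_⟩, Real.rpow_inv_rpow hy.le hr.ne⟩
    · have := Real.rpow_lt_rpow_of_neg hy h2 (inv_lt_zero.2 hr)
      rwa [hinv ha] at this
    · have := Real.rpow_lt_rpow_of_neg (Real.rpow_pos_of_pos hb r) h1 (inv_lt_zero.2 hr)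
      rwa [hinv hb] at this

/-- The density of a negative power of a GPFP random variable. -/
noncomputable def gpfpPowerData {a b : ℝ} (ha : 0 < a) (hab : a < b) {N : ℕ} {α l : Fin N → ℝ}
    (hα : ∀ k, 0 < α k) (hl0 : ∀ k, 0 ≤ l k) (hl1 : ∀ k, l k ≤ 1) {r : ℝ} (hr : r ≤ -1) :
    PowerData N where
  p := b ^ r
  q := a ^ r
  t := -r⁻¹
  β k := -r⁻¹ * √(a * b) * α k
  e k := 1 + -r⁻¹ * (1 - l k)
  p_pos := Real.rpow_pos_of_pos (ha.trans hab) r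
  p_lt_q := Real.rpow_lt_rpow_of_neg ha hab (by linarith)
  t_pos := neg_pos.2 (inv_lt_zero.2 (by linarith))
  t_le_one := by
    rw [← inv_neg]
    exact inv_le_one_of_one_le₀ (by linarith)
  β_pos k := by
    have := neg_pos.2 (inv_lt_zero.2 (show r < 0 by linarith))
    have := ha.trans hab
    have := hα k
    positivity
  one_le_e k := by
    have := neg_pos.2 (inv_lt_zero.2 (show r < 0 by linarith))
    have := mul_nonneg this.le (sub_nonneg.2 (hl1 k))
    linarith
  e_le k := by
    have := neg_pos.2 (inv_lt_zero.2 (show r < 0 by linarith))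
    have := mul_nonneg this.le (hl0 k)
    linarith

section

variable {a b : ℝ} (ha : 0 < a) (hab : a < b) {N : ℕ} {α l : Fin N → ℝ}
  (hα : ∀ k, 0 < α k) (hl0 : ∀ k, 0 ≤ l k) (hl1 : ∀ k, l k ≤ 1) {r : ℝ} (hr : r ≤ -1)

theorem gpfpPowerData_density {x : ℝ} (hx : x ∈ Set.Ioo a b) :
    |r * x ^ (r - 1)| * (gpfpPowerData ha hab hα hl0 hl1 hr).density (x ^ r) =
      gpfpDensity a b N α l x := by
  have hr0 : r < 0 := by linarith
  have hx0 : 0 < x := ha.trans hx.1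
  have hb : 0 < b := ha.trans hab
  have hpow : ∀ {c : ℝ}, 0 < c → (c ^ r) ^ (-r⁻¹) = c⁻¹ := fun {c} hc => by
    rw [← Real.rpow_mul hc.le, mul_neg, mul_inv_cancel₀ hr0.ne, Real.rpow_neg_one]
  have hsq : √((a⁻¹ - x⁻¹) * (x⁻¹ - b⁻¹)) = √((b - x) * (x - a)) / (√(a * b) * x) := by
    have h1 : (a⁻¹ - x⁻¹) * (x⁻¹ - b⁻¹) = (b - x) * (x - a) / ((a * b) * x ^ 2) := by
      field_simp
    rw [h1, Real.sqrt_div' _ (by positivity), Real.sqrt_mul (mul_pos ha hb).le,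
      Real.sqrt_sq hx0.le]
  have hterm : ∀ k, x ^ (r - 1) * (x ^ r) ^ (-(1 + -r⁻¹ * (1 - l k))) = x ^ (-(l k)) := by
    intro k
    rw [← Real.rpow_mul hx0.le, ← Real.rpow_add hx0]
    congr 1
    linear_combination (1 - l k) * mul_inv_cancel₀ hr0.ne
  rw [abs_mul, abs_of_neg hr0, abs_of_pos (Real.rpow_pos_of_pos hx0 _), gpfpDensity,
    PowerData.density]
  simp only [gpfpPowerData]
  rw [hpow ha, hpow hb, hpow hx0, hsq]
  have hsum : ∑ k, -r⁻¹ * √(a * b) * α k * (x ^ r) ^ (-(1 + -r⁻¹ * (1 - l k))) * x ^ (r - 1) =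
      -r⁻¹ * √(a * b) * ∑ k, α k * x ^ (-(l k)) := by
    rw [Finset.mul_sum]
    refine Finset.sum_congr rfl fun k _ => ?_
    rw [← hterm k]
    ring
  rw [← Finset.sum_mul] at hsum
  have hs : √(a * b) ≠ 0 := (Real.sqrt_pos.2 (mul_pos ha hb)).ne'
  calc _ = -r * (√((b - x) * (x - a)) / (√(a * b) * x)) *
        ((∑ k, -r⁻¹ * √(a * b) * α k * (x ^ r) ^ (-(1 + -r⁻¹ * (1 - l k)))) * x ^ (r - 1)) := by
        ring
    _ = _ := by
        rw [hsum]
        field_simp [hr0.ne]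

theorem cauchyTransform_map_rpow_GPFP (z : ℂ) :
    cauchyTransform (Measure.map (fun x : ℝ => x ^ r) (GPFP a b N α l)) z =
      (gpfpPowerData ha hab hα hl0 hl1 hr).G z := by
  have hr0 : r < 0 := by linarith
  have hderiv : ∀ x ∈ Set.Ioo a b,
      HasDerivWithinAt (fun x : ℝ => x ^ r) (r * x ^ (r - 1)) (Set.Ioo a b) x := fun x hx =>
    (Real.hasDerivAt_rpow_const (Or.inl (ha.trans hx.1).ne')).hasDerivWithinAt
  have hinj : Set.InjOn (fun x : ℝ => x ^ r) (Set.Ioo a b) := fun x hx y hy h =>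
    (Real.rpow_left_inj (ha.trans hx.1).le (ha.trans hy.1).le hr0.ne).1 h
  rw [cauchyTransform, integral_map (by fun_prop)
    (by fun_prop : Measurable fun y : ℝ => (z - y : ℂ)⁻¹).aestronglyMeasurable,
    integral_GPFP ha hα, PowerData.G, cauchyInt,
    show Set.Ioo (gpfpPowerData ha hab hα hl0 hl1 hr).p (gpfpPowerData ha hab hα hl0 hl1 hr).q =
      (fun x : ℝ => x ^ r) '' Set.Ioo a b from (rpow_image_Ioo ha (ha.trans hab) hr0).symm,
    integral_image_eq_integral_abs_deriv_smul measurableSet_Ioo hderiv hinj]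
  refine MeasureTheory.setIntegral_congr_fun measurableSet_Ioo fun x hx => ?_
  simp only [Complex.real_smul]
  rw [← gpfpPowerData_density ha hab hα hl0 hl1 hr hx, Complex.ofReal_mul, mul_assoc]

end

/-- If `X ~ GPFP(a,b,N,α,l)` with `0 ≤ l₁ < ⋯ < l_N ≤ 1`, then `X^r ∈ UI`
for every `r ≤ -1`. -/
theorem gpfp_negative_power_UI (a b : ℝ) (ha : 0 < a) (hab : a < b)
    (N : ℕ) (hN : 0 < N) (α l : Fin N → ℝ)
    (hα : ∀ k, 0 < α k) (hl : StrictMono l)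
    (hl0 : ∀ k, 0 ≤ l k) (hl1 : ∀ k, l k ≤ 1)
    (hprob : IsProbabilityMeasure (GPFP a b N α l))
    (r : ℝ) (hr : r ≤ -1) :
    IsUI (Measure.map (fun x : ℝ => x ^ r) (GPFP a b N α l)) := by
  set P := gpfpPowerData ha hab hα hl0 hl1 hr with hP
  have he : ∀ k : Fin N, k ≠ ⟨0, hN⟩ → P.e k < P.e ⟨0, hN⟩ := by
    intro k hk
    have hlt : l ⟨0, hN⟩ < l k := hl (lt_of_le_of_ne (Nat.zero_le _) hk.symm)
    have := mul_lt_mul_of_pos_left hlt P.t_pos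
    simp only [hP, gpfpPowerData] at this ⊢
    linarith
  obtain ⟨F, hF, hinj, δ, hδ, h⟩ := P.exists_univalent_inverse hN he
  refine ⟨F, hF, hinj, 1, one_pos, δ / 2, by linarith, fun w hw hw' => ?_⟩
  rw [one_mul] at hw
  have him : w.im < 0 := by linarith [abs_nonneg w.re]
  rw [cauchyTransform_map_rpow_GPFP ha hab hα hl0 hl1 hr]
  refine h w ?_ him
  have := Complex.norm_le_abs_re_add_abs_im w
  rw [abs_of_neg him] at this
  linarith
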